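/- arXiv:1101.2148 — 2 statements merged into one kernel-verified Lean document; each statement's English description precedes it below -/
import Mathlib

section
/- Fix δ₀ ∈ (0,1) and δ₀ < |E| < 2 − δ₀, and let ν = ν_E^{(λ)} be the Furstenberg measure. There exist C > 0 and λ₀ > 0 such that for 0 < λ < λ₀ and every arc I of the circle with |I| ≤ λ: ν(I) ≤ e^{C |log λ|^{1/2}} [ max_{|J| < λ^{1/10}|I|} ν(J) + max_{λ^{−1/10} < D < λ^{−1/5}} (1/D) max_{|J| < D|I|} ν(J) ], where J ranges over arcs of the circle. -/
open MeasureTheory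

noncomputable section

instance : Fact (0 < 2 * Real.pi) := ⟨by have := Real.pi_pos; linarith⟩

/-- Single-step Anderson–Bernoulli matrix `g_E(ε) = [[E - λε, -1],[1,0]]`. -/
def gE (lam E x : ℝ) : Matrix (Fin 2) (Fin 2) ℝ := !![E - lam * x, -1; 1, 0]

/-- The projective action `τ_g(θ)` of `g ∈ SL₂(ℝ)`, as a point of the circle
`ℝ/2πℤ`: the argument of `(a cos θ + b sin θ) + i (c cos θ + d sin θ)`. -/
def tauC (g : Matrix (Fin 2) (Fin 2) ℝ) (θ : ℝ) : AddCircle (2 * Real.pi) :=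
  ((Complex.arg ((g 0 0 * Real.cos θ + g 0 1 * Real.sin θ : ℝ) +
      Complex.I * (g 1 0 * Real.cos θ + g 1 1 * Real.sin θ : ℝ)) : ℝ) :
    AddCircle (2 * Real.pi))

/-- The projective action of `g` as a self-map of the circle `ℝ/2πℤ`. -/
def tauMap (g : Matrix (Fin 2) (Fin 2) ℝ) :
    AddCircle (2 * Real.pi) → AddCircle (2 * Real.pi) :=
  AddCircle.liftIco (2 * Real.pi) 0 fun θ => tauC g θ

/-- The arc of the circle `ℝ/2πℤ` obtained by projecting the interval `(a, a+l)`. -/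
def arc (a l : ℝ) : Set (AddCircle (2 * Real.pi)) :=
  (fun θ : ℝ => (θ : AddCircle (2 * Real.pi))) '' Set.Ioo a (a + l)

/-- `max_{|J| < s} ν(J)` over arcs `J` of the circle. -/
def arcSupLt (ν : Measure (AddCircle (2 * Real.pi))) (s : ℝ) : ENNReal :=
  ⨆ (a : ℝ) (l : ℝ) (_ : l < s), ν (arc a l)

/-- `ν` is stationary for `μ_{λ,E} = ½ δ_{g_E(1)} + ½ δ_{g_E(-1)}`
(the defining property of the Furstenberg measure `ν_E^{(λ)}`). -/
def Stationary (lam E : ℝ) (ν : Measure (AddCircle (2 * Real.pi))) : Prop :=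
  ∀ s : Set (AddCircle (2 * Real.pi)), MeasurableSet s →
    ν s = (ν (tauMap (gE lam E 1) ⁻¹' s) + ν (tauMap (gE lam E (-1)) ⁻¹' s)) / 2

lemma one_add_rpow_le {η x : ℝ} (hη : 0 < η) (hη' : η ≤ 1 / 32) (hx : |x| ≤ 1 / 8) :
    (1 + x) ^ η ≤ 1 + η * x - η / 8 * x ^ 2 := by
  have hx1 := abs_le.1 hx
  have hpos : 0 < 1 + x := by linarith
  have hlog := Real.abs_log_sub_add_sum_range_le (x := -x) (by rw [abs_neg]; linarith) 2
  simp only [Finset.sum_range_succ, Finset.sum_range_zero, abs_neg, sub_neg_eq_add] at hlog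
  norm_num at hlog
  have hsq : |x| ^ 2 = x ^ 2 := sq_abs x
  have hrem : |x| ^ 3 / (1 - |x|) ≤ x ^ 2 / 7 := by
    rw [div_le_div_iff₀ (by linarith) (by norm_num)]
    have h0 := abs_nonneg x
    nlinarith [mul_nonneg (sq_nonneg x) (by linarith : 0 ≤ 1 / 8 - |x|)]
  have hy := abs_le.1 (hlog.trans hrem)
  set y := Real.log (1 + x) with hydef
  have hyle : y ≤ x - x ^ 2 / 4 := by nlinarith [sq_nonneg x]
  have hyabs : |y| ≤ 2 * |x| := by
    have : |y - x| ≤ |x| := by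
      rw [abs_le]
      have h2 : x ^ 2 ≤ |x| / 8 := by nlinarith [abs_nonneg x]
      constructor <;> nlinarith [abs_nonneg x]
    calc |y| = |(y - x) + x| := by ring_nf
      _ ≤ |y - x| + |x| := abs_add_le _ _
      _ ≤ 2 * |x| := by linarith
  have hy2 : y ^ 2 ≤ 4 * x ^ 2 := by
    rw [← sq_abs y, ← hsq]
    nlinarith [abs_nonneg y, abs_nonneg x]
  have hsmall : |y * η| ≤ 1 := by
    rw [abs_mul, abs_of_pos hη]
    nlinarith [abs_nonneg y]
  have hexp := (abs_le.1 (Real.abs_exp_sub_one_sub_id_le hsmall)).2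
  rw [Real.rpow_def_of_pos hpos]
  have h3 : η * η * y ^ 2 ≤ η * (1 / 32) * (4 * x ^ 2) := by gcongr
  nlinarith [mul_le_mul_of_nonneg_left hyle hη.le]

lemma one_add_rpow_sub_one_le {η x : ℝ} (hη : 0 < η) (hη' : η ≤ 1 / 32) (hx : |x| ≤ 1 / 8) :
    (1 + x) ^ (η - 1) ≤ 1 - (1 - η) * x + (1 - η - η / 8) * x ^ 2 + 2 * |x| ^ 3 := by
  have hx1 := abs_le.1 hx
  have hpos : 0 < 1 + x := by linarith
  rw [Real.rpow_sub_one hpos.ne', div_le_iff₀ hpos]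
  refine (one_add_rpow_le hη hη' hx).trans ?_
  have h3 : |x ^ 3| = |x| ^ 3 := abs_pow x 3
  have h4 := neg_abs_le (x ^ 3)
  rw [h3] at h4
  have h5 : 0 ≤ |x| ^ 3 := by positivity
  have h6 : -|x| ^ 3 ≤ (1 - η - η / 8) * x ^ 3 := by
    nlinarith [mul_le_mul_of_nonneg_left h4 (by linarith : 0 ≤ 1 - η - η / 8)]
  nlinarith [mul_nonneg h5 (by linarith : 0 ≤ x + 1 / 8)]

/-- The inverse transfer matrix in the coordinate where the free matrix is a rotation: a shear
followed by multiplication by `ω`. -/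
def shearRot (ω : ℂ) (t : ℝ) (z : ℂ) : ℂ := ω * (z + (t * z.im : ℝ))

lemma shearRot_smul (ω : ℂ) (t r : ℝ) (z : ℂ) :
    shearRot ω t (r * z) = r * shearRot ω t z := by
  simp only [shearRot, Complex.im_ofReal_mul]
  push_cast
  ring

lemma norm_sq_shearRot {ω : ℂ} (hω : ‖ω‖ = 1) (t : ℝ) (z : ℂ) :
    ‖shearRot ω t z‖ ^ 2 = ‖z‖ ^ 2 + (2 * t * z.re * z.im + t ^ 2 * z.im ^ 2) := by
  rw [shearRot, norm_mul, hω, one_mul, Complex.sq_norm, Complex.sq_norm, Complex.normSq_apply,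
    Complex.normSq_apply]
  simp
  ring

/-- A trigonometric polynomial with frequencies `2` and `4`. -/
def trigPoly (a b u : ℂ) : ℝ := (a * u ^ 2 + b * u ^ 4).re

lemma abs_trigPoly_sub_le (a b : ℂ) {u v : ℂ} (hu : ‖u‖ = 1) (hv : ‖v‖ = 1) :
    |trigPoly a b v - trigPoly a b u| ≤ 4 * (‖a‖ + ‖b‖) * ‖v - u‖ := by
  rw [trigPoly, trigPoly, ← Complex.sub_re]
  refine (Complex.abs_re_le_norm _).trans ?_
  have h1 : a * v ^ 2 + b * v ^ 4 - (a * u ^ 2 + b * u ^ 4) =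
      (a * (v + u) + b * ((v + u) * (v ^ 2 + u ^ 2))) * (v - u) := by ring
  rw [h1, norm_mul]
  gcongr
  have h2 : ‖v + u‖ ≤ 2 := (norm_add_le _ _).trans (by rw [hu, hv]; norm_num)
  have h3 : ‖v ^ 2 + u ^ 2‖ ≤ 2 := (norm_add_le _ _).trans (by rw [norm_pow, norm_pow, hu, hv]; norm_num)
  calc ‖a * (v + u) + b * ((v + u) * (v ^ 2 + u ^ 2))‖
      ≤ ‖a‖ * ‖v + u‖ + ‖b‖ * (‖v + u‖ * ‖v ^ 2 + u ^ 2‖) := by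
        refine (norm_add_le _ _).trans ?_
        rw [norm_mul, norm_mul, norm_mul]
    _ ≤ ‖a‖ * 2 + ‖b‖ * (2 * 2) := by gcongr
    _ ≤ 4 * (‖a‖ + ‖b‖) := by nlinarith [norm_nonneg a]

lemma abs_trigPoly_le (a b : ℂ) {u : ℂ} (hu : ‖u‖ ≤ 1) : |trigPoly a b u| ≤ ‖a‖ + ‖b‖ := by
  refine (Complex.abs_re_le_norm _).trans ((norm_add_le _ _).trans ?_)
  rw [norm_mul, norm_mul, norm_pow, norm_pow]
  have h2 : ‖u‖ ^ 2 ≤ 1 := pow_le_one₀ (norm_nonneg _) hu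
  have h4 : ‖u‖ ^ 4 ≤ 1 := pow_le_one₀ (norm_nonneg _) hu
  nlinarith [norm_nonneg a, norm_nonneg b]

/-- Almost a power of the projective derivative at `z`, corrected at second order so that its
average decreases under a random `shearRot`. -/
def potential (η β : ℝ) (a b z : ℂ) : ℝ :=
  (‖z‖ ^ 2) ^ (η - 1) * (1 + β ^ 2 * trigPoly a b (z / ‖z‖))

lemma potential_smul (η β : ℝ) (a b z : ℂ) {r : ℝ} (hr : 0 < r) :
    potential η β a b (r * z) = (r ^ 2) ^ (η - 1) * potential η β a b z := by
  have h1 : ‖(r : ℂ) * z‖ = r * ‖z‖ := by rw [norm_mul, Complex.norm_of_nonneg hr.le]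
  have h2 : (r : ℂ) * z / (‖(r : ℂ) * z‖ : ℝ) = z / ‖z‖ := by
    rw [h1]
    push_cast
    exact mul_div_mul_left _ _ (by exact_mod_cast hr.ne')
  rw [potential, potential, h2, h1, mul_pow, Real.mul_rpow (by positivity) (by positivity)]
  ring

lemma norm_shearRot_bounds {ω : ℂ} (hω : ‖ω‖ = 1) {t : ℝ} (ht : |t| ≤ 1 / 32) {u : ℂ}
    (hu : ‖u‖ = 1) :
    |‖shearRot ω t u‖ - 1| ≤ |t| ∧
      ‖shearRot ω t u / ‖shearRot ω t u‖ - ω * u‖ ≤ 4 * |t| := by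
  have him : |u.im| ≤ 1 := hu ▸ Complex.abs_im_le_norm u
  have hd : ‖shearRot ω t u - ω * u‖ ≤ |t| := by
    rw [shearRot, mul_add, add_sub_cancel_left, norm_mul, hω, one_mul, Complex.norm_real,
      Real.norm_eq_abs, abs_mul]
    nlinarith [abs_nonneg t]
  have hω1 : ‖ω * u‖ = 1 := by rw [norm_mul, hω, hu, one_mul]
  have h1 : |‖shearRot ω t u‖ - 1| ≤ |t| := by
    rw [← hω1]
    exact (abs_norm_sub_norm_le _ _).trans hd
  refine ⟨h1, ?_⟩
  set z := shearRot ω t u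
  have hz := abs_le.1 h1
  have hz0 : 0 < ‖z‖ := by linarith
  have hz0' : (‖z‖ : ℂ) ≠ 0 := by exact_mod_cast hz0.ne'
  have h2 : z / ‖z‖ - ω * u = ((z - ω * u) - ((‖z‖ - 1 : ℝ) : ℂ) * (ω * u)) / ‖z‖ := by
    field_simp
    push_cast
    ring
  rw [h2, norm_div, Complex.norm_real, norm_norm, div_le_iff₀ hz0]
  refine (norm_sub_le _ _).trans ?_
  rw [norm_mul, hω1, Complex.norm_real, Real.norm_eq_abs]
  nlinarith [abs_nonneg t]

lemma potential_shearRot_le {ω a₀ b₀ : ℂ} (hω : ‖ω‖ = 1) {η β t : ℝ} (hη : 0 < η)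
    (hη' : η ≤ 1 / 32) (ht : |t| = β) (hβη : 32 * (17 + 20 * (‖a₀‖ + ‖b₀‖)) * β ≤ η)
    {u : ℂ} (hu : ‖u‖ = 1) :
    potential η β ((1 - η : ℝ) * a₀) ((1 - η - η / 8 : ℝ) * b₀) (shearRot ω t u) ≤
      1 - (1 - η) * (2 * t * u.re * u.im + t ^ 2 * u.im ^ 2) +
        (1 - η - η / 8) * (2 * t * u.re * u.im + t ^ 2 * u.im ^ 2) ^ 2 + 16 * β ^ 3 +
        β ^ 2 * trigPoly ((1 - η : ℝ) * a₀) ((1 - η - η / 8 : ℝ) * b₀) (ω * u) +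
        20 * (‖a₀‖ + ‖b₀‖) * β ^ 3 := by
  set S := ‖a₀‖ + ‖b₀‖ with hS
  have hS0 : 0 ≤ S := by positivity
  have hβ0 : 0 ≤ β := ht ▸ abs_nonneg t
  have hSβ0 : 0 ≤ S * β := by positivity
  have hβ : β ≤ 1 / 32 := by linarith
  have hSβ : S * β ≤ 1 := by linarith
  set a : ℂ := (1 - η : ℝ) * a₀
  set b : ℂ := (1 - η - η / 8 : ℝ) * b₀
  have hab : ‖a‖ + ‖b‖ ≤ S := by
    have ha : ‖a‖ ≤ ‖a₀‖ := by
      rw [norm_mul, Complex.norm_of_nonneg (by linarith)]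
      nlinarith [norm_nonneg a₀]
    have hb : ‖b‖ ≤ ‖b₀‖ := by
      rw [norm_mul, Complex.norm_of_nonneg (by linarith)]
      nlinarith [norm_nonneg b₀]
    linarith
  set X := 2 * t * u.re * u.im + t ^ 2 * u.im ^ 2 with hX
  have hnorm : ‖shearRot ω t u‖ ^ 2 = 1 + X := by
    rw [norm_sq_shearRot hω, hu]; ring
  have hxy : u.re ^ 2 + u.im ^ 2 = 1 := by
    have := Complex.sq_norm u
    rw [hu, Complex.normSq_apply] at this
    nlinarith
  have hXabs : |X| ≤ 2 * β := by
    have h1 : |2 * (u.re * u.im)| ≤ 1 := by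
      rw [abs_le]; constructor <;> nlinarith [sq_nonneg (u.re + u.im), sq_nonneg (u.re - u.im)]
    have h2 : |X| ≤ |t| * |2 * (u.re * u.im)| + t ^ 2 * u.im ^ 2 := by
      have h : X = t * (2 * (u.re * u.im)) + t ^ 2 * u.im ^ 2 := by rw [hX]; ring
      rw [h, ← abs_mul]
      refine (abs_add_le _ _).trans ?_
      rw [abs_of_nonneg (by positivity : 0 ≤ t ^ 2 * u.im ^ 2)]
    have h3 : t ^ 2 = β ^ 2 := by rw [← ht, sq_abs]
    have h4 : t ^ 2 * u.im ^ 2 ≤ β ^ 2 := by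
      rw [h3]; nlinarith [sq_nonneg u.re, sq_nonneg β]
    rw [ht] at h2
    nlinarith
  obtain ⟨h1, h2⟩ := norm_shearRot_bounds hω (t := t) (by linarith) hu
  have hz0 : 0 < ‖shearRot ω t u‖ := by linarith [(abs_le.1 h1).1]
  set v := shearRot ω t u / ‖shearRot ω t u‖ with hv
  have hv1 : ‖v‖ = 1 := by
    rw [hv, norm_div, Complex.norm_real, norm_norm, div_self hz0.ne']
  have hω1 : ‖ω * u‖ = 1 := by rw [norm_mul, hω, hu, one_mul]
  have htr : trigPoly a b v ≤ trigPoly a b (ω * u) + 16 * S * β := by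
    have h3 := (abs_le.1 (abs_trigPoly_sub_le a b hω1 hv1)).2
    have h4 : 4 * (‖a‖ + ‖b‖) * ‖v - ω * u‖ ≤ 4 * S * (4 * β) := by
      rw [← ht]; gcongr
    linarith
  have htv := abs_le.1 ((abs_trigPoly_le a b hv1.le).trans hab)
  have hY := one_add_rpow_sub_one_le hη hη' (x := X) (by linarith)
  have hX3 : |X| ^ 3 ≤ 8 * β ^ 3 := by
    calc |X| ^ 3 ≤ (2 * β) ^ 3 := by gcongr
      _ = _ := by ring
  have hX2 : X ^ 2 ≤ 4 * β ^ 2 := by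
    rw [← sq_abs]
    calc |X| ^ 2 ≤ (2 * β) ^ 2 := by gcongr
      _ = _ := by ring
  set Y := 1 - (1 - η) * X + (1 - η - η / 8) * X ^ 2 + 16 * β ^ 3 with hYdef
  have hYle : (1 + X) ^ (η - 1) ≤ Y := by rw [hYdef]; linarith
  have hβ2 : β ^ 2 ≤ β / 32 := by linarith [mul_le_mul_of_nonneg_left hβ hβ0, sq β]
  have hβ3 : β ^ 3 ≤ β / 32 := by
    calc β ^ 3 = β * β ^ 2 := by ring
      _ ≤ β * (1 / 32) := by gcongr; linarith
      _ = β / 32 := by ring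
  have hβ30 : 0 ≤ β ^ 3 := by positivity
  have hXb := abs_le.1 hXabs
  have hY1 : |Y - 1| ≤ 4 * β := by
    rw [abs_le, hYdef]
    have h5 : 0 ≤ (1 - η - η / 8) * X ^ 2 := mul_nonneg (by linarith) (sq_nonneg _)
    have h6 : (1 - η - η / 8) * X ^ 2 ≤ X ^ 2 :=
      mul_le_of_le_one_left (sq_nonneg _) (by linarith)
    have h7 : |(1 - η) * X| ≤ 1 * (2 * β) := by
      rw [abs_mul, abs_of_nonneg (by linarith : 0 ≤ 1 - η)]
      gcongr
      linarith
    have h8 := abs_le.1 h7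
    constructor <;> linarith [h8.1, h8.2]
  have hβS : β ^ 2 * S ≤ 1 := by
    calc β ^ 2 * S = β * (S * β) := by ring
      _ ≤ 1 * 1 := by gcongr; linarith
      _ = 1 := one_mul 1
  have hpos : 0 ≤ 1 + β ^ 2 * trigPoly a b v := by
    linarith [mul_le_mul_of_nonneg_left htv.1 (sq_nonneg β)]
  have hprod : (Y - 1) * trigPoly a b v ≤ 4 * β * S := by
    refine (le_abs_self _).trans ?_
    rw [abs_mul]
    exact mul_le_mul hY1 (abs_le.2 htv) (abs_nonneg _) (by positivity)
  rw [potential, hnorm]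
  calc (1 + X) ^ (η - 1) * (1 + β ^ 2 * trigPoly a b v)
      ≤ Y * (1 + β ^ 2 * trigPoly a b v) := by gcongr
    _ = Y + β ^ 2 * (trigPoly a b v + (Y - 1) * trigPoly a b v) := by ring
    _ ≤ Y + β ^ 2 * ((trigPoly a b (ω * u) + 16 * S * β) + 4 * β * S) := by gcongr
    _ = _ := by ring

lemma avg_potential_unit_le {ω a₀ b₀ : ℂ} (hω : ‖ω‖ = 1) (ha₀ : a₀ * (ω ^ 2 - 1) = -1 / 2)
    (hb₀ : b₀ * (ω ^ 4 - 1) = 1 / 2) {η β : ℝ} (hη : 0 < η)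
    (hη' : η ≤ 1 / 32) (hβ : 0 < β) (hβη : 32 * (17 + 20 * (‖a₀‖ + ‖b₀‖)) * β ≤ η)
    {u : ℂ} (hu : ‖u‖ = 1) :
    (potential η β ((1 - η : ℝ) * a₀) ((1 - η - η / 8 : ℝ) * b₀) (shearRot ω β u) +
      potential η β ((1 - η : ℝ) * a₀) ((1 - η - η / 8 : ℝ) * b₀) (shearRot ω (-β) u)) / 2 ≤
      (1 - β ^ 2 * η / 64) *
        potential η β ((1 - η : ℝ) * a₀) ((1 - η - η / 8 : ℝ) * b₀) u := by
  have h1 := potential_shearRot_le hω hη hη' (abs_of_pos hβ) hβη hu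
  have h2 := potential_shearRot_le hω hη hη' (by rw [abs_neg, abs_of_pos hβ] : |-β| = β) hβη hu
  have hsum : trigPoly ((1 - η : ℝ) * a₀) ((1 - η - η / 8 : ℝ) * b₀) (ω * u) =
      trigPoly ((1 - η : ℝ) * a₀) ((1 - η - η / 8 : ℝ) * b₀) u -
        (1 - η) / 2 * (u ^ 2).re + (1 - η - η / 8) / 2 * (u ^ 4).re := by
    have h : ((1 - η : ℝ) * a₀) * (ω * u) ^ 2 + ((1 - η - η / 8 : ℝ) * b₀) * (ω * u) ^ 4 =
        (((1 - η : ℝ) * a₀) * u ^ 2 + ((1 - η - η / 8 : ℝ) * b₀) * u ^ 4) +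
        ((-((1 - η) / 2) : ℝ) * u ^ 2 + ((1 - η - η / 8) / 2 : ℝ) * u ^ 4) := by
      push_cast
      linear_combination ((1 : ℂ) - η) * u ^ 2 * ha₀ + ((1 : ℂ) - η - η / 8) * u ^ 4 * hb₀
    rw [trigPoly, h, Complex.add_re, ← trigPoly, Complex.add_re, Complex.re_ofReal_mul,
      Complex.re_ofReal_mul]
    ring
  have hxy : u.re ^ 2 + u.im ^ 2 = 1 := by
    have := Complex.sq_norm u
    rw [hu, Complex.normSq_apply] at this
    nlinarith
  have hu2 : (u ^ 2).re = 1 - 2 * u.im ^ 2 := by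
    rw [sq, Complex.mul_re]; linarith
  have hu4 : (u ^ 4).re = 1 - 8 * (u.re ^ 2 * u.im ^ 2) := by
    have : u ^ 4 = u ^ 2 * u ^ 2 := by ring
    have him : (u ^ 2).im = 2 * u.re * u.im := by rw [sq, Complex.mul_im]; ring
    rw [this, Complex.mul_re, hu2, him]
    have h : u.re ^ 2 = 1 - u.im ^ 2 := by linarith
    linear_combination (4 * u.im ^ 2) * h
  set S := ‖a₀‖ + ‖b₀‖ with hS
  have hS0 : 0 ≤ S := by positivity
  have hpu : potential η β ((1 - η : ℝ) * a₀) ((1 - η - η / 8 : ℝ) * b₀) u =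
      1 + β ^ 2 * trigPoly ((1 - η : ℝ) * a₀) ((1 - η - η / 8 : ℝ) * b₀) u := by
    rw [potential, hu]; simp
  rw [hpu]
  have hab : ‖((1 - η : ℝ) * a₀ : ℂ)‖ + ‖((1 - η - η / 8 : ℝ) * b₀ : ℂ)‖ ≤ S := by
    rw [norm_mul, norm_mul, Complex.norm_of_nonneg (by linarith),
      Complex.norm_of_nonneg (by linarith)]
    nlinarith [norm_nonneg a₀, norm_nonneg b₀]
  have hψ := abs_le.1 ((abs_trigPoly_le _ _ hu.le).trans hab)
  set ψ := trigPoly ((1 - η : ℝ) * a₀) ((1 - η - η / 8 : ℝ) * b₀) u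
  rw [hsum, hu2, hu4] at h1 h2
  have hSβ0 : 0 ≤ S * β := by positivity
  have hβ1 : β ≤ 1 := by linarith
  have hSβ : S * β ≤ 1 := by linarith
  have hψβ : β ^ 2 * ψ ≤ 1 := by
    calc β ^ 2 * ψ ≤ β ^ 2 * S := by gcongr; exact hψ.2
      _ = β * (S * β) := by ring
      _ ≤ 1 * 1 := by gcongr
      _ = 1 := by norm_num
  have hmain : β ^ 2 * (32 * (17 + 20 * S) * β) ≤ β ^ 2 * η := by gcongr
  have h4 : (1 - η - η / 8) * (β ^ 4 * u.im ^ 4) ≤ β ^ 3 := by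
    have hy2 : u.im ^ 2 ≤ 1 := by linarith [sq_nonneg u.re]
    have hy4 : u.im ^ 4 ≤ 1 := by
      calc u.im ^ 4 = (u.im ^ 2) ^ 2 := by ring
        _ ≤ 1 := pow_le_one₀ (sq_nonneg _) hy2
    calc (1 - η - η / 8) * (β ^ 4 * u.im ^ 4) ≤ 1 * (β ^ 4 * 1) := by
          gcongr; linarith
      _ = β ^ 3 * β := by ring
      _ ≤ β ^ 3 * 1 := by gcongr
      _ = β ^ 3 := by ring
  have h5 : β ^ 2 * η / 64 * (β ^ 2 * ψ) ≤ β ^ 2 * η / 64 * 1 := by gcongr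
  linarith

lemma avg_potential_le {ω a₀ b₀ : ℂ} (hω : ‖ω‖ = 1) (ha₀ : a₀ * (ω ^ 2 - 1) = -1 / 2)
    (hb₀ : b₀ * (ω ^ 4 - 1) = 1 / 2) {η β : ℝ} (hη : 0 < η)
    (hη' : η ≤ 1 / 32) (hβ : 0 < β) (hβη : 32 * (17 + 20 * (‖a₀‖ + ‖b₀‖)) * β ≤ η)
    {z : ℂ} (hz : z ≠ 0) :
    (potential η β ((1 - η : ℝ) * a₀) ((1 - η - η / 8 : ℝ) * b₀) (shearRot ω β z) +
      potential η β ((1 - η : ℝ) * a₀) ((1 - η - η / 8 : ℝ) * b₀) (shearRot ω (-β) z)) / 2 ≤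
      (1 - β ^ 2 * η / 64) *
        potential η β ((1 - η : ℝ) * a₀) ((1 - η - η / 8 : ℝ) * b₀) z := by
  have hr : 0 < ‖z‖ := norm_pos_iff.2 hz
  have hr' : (‖z‖ : ℂ) ≠ 0 := by exact_mod_cast hr.ne'
  have hu : ‖z / ‖z‖‖ = 1 := by rw [norm_div, Complex.norm_real, norm_norm, div_self hr.ne']
  have h := avg_potential_unit_le hω ha₀ hb₀ hη hη' hβ hβη hu
  have hzu : z = ‖z‖ * (z / ‖z‖) := (mul_div_cancel₀ z hr').symm
  set u := z / ‖z‖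
  set r := ‖z‖
  rw [hzu, shearRot_smul, shearRot_smul, potential_smul _ _ _ _ _ hr, potential_smul _ _ _ _ _ hr,
    potential_smul _ _ _ _ _ hr]
  have hc : 0 ≤ (r ^ 2) ^ (η - 1) := by positivity
  nlinarith [mul_le_mul_of_nonneg_left h hc]

lemma potential_bounds {η β S : ℝ} {a b : ℂ} (hab : ‖a‖ + ‖b‖ ≤ S) (hβS : β ^ 2 * S ≤ 1 / 2)
    (z : ℂ) :
    (‖z‖ ^ 2) ^ (η - 1) / 2 ≤ potential η β a b z ∧
      potential η β a b z ≤ 2 * (‖z‖ ^ 2) ^ (η - 1) := by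
  have hz : ‖z / ‖z‖‖ ≤ 1 := by
    rw [norm_div, Complex.norm_real, norm_norm]
    exact div_self_le_one _
  have h := abs_le.1 ((abs_trigPoly_le a b hz).trans hab)
  have h1 := mul_le_mul_of_nonneg_left h.1 (sq_nonneg β)
  have h2 := mul_le_mul_of_nonneg_left h.2 (sq_nonneg β)
  have hc : 0 ≤ (‖z‖ ^ 2) ^ (η - 1) := by positivity
  rw [potential]
  constructor
  · linarith [mul_le_mul_of_nonneg_left
      (by linarith : 1 / 2 ≤ 1 + β ^ 2 * trigPoly a b (z / ‖z‖)) hc]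
  · linarith [mul_le_mul_of_nonneg_left
      (by linarith : 1 + β ^ 2 * trigPoly a b (z / ‖z‖) ≤ 2) hc]

/-- The oriented area spanned by two planar vectors. -/
def cross (z w : ℂ) : ℝ := z.re * w.im - z.im * w.re

/-- The Euclidean inner product of two planar vectors. -/
def dot (z w : ℂ) : ℝ := z.re * w.re + z.im * w.im

/-- The sine of the oriented angle between two planar vectors. -/
def sinAngle (z w : ℂ) : ℝ := cross z w / (‖z‖ * ‖w‖)

/-- The cone spanned by `z` and `w` is nonempty, with an acute opening angle. -/
def AcutePair (z w : ℂ) : Prop := 0 < cross z w ∧ 0 < dot z w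

lemma cross_shearRot {ω : ℂ} (hω : ‖ω‖ = 1) (t : ℝ) (z w : ℂ) :
    cross (shearRot ω t z) (shearRot ω t w) = cross z w := by
  have h := Complex.sq_norm ω
  rw [hω, Complex.normSq_apply] at h
  simp only [cross, shearRot, Complex.mul_re, Complex.mul_im, Complex.add_re, Complex.add_im,
    Complex.ofReal_re, Complex.ofReal_im]
  linear_combination (-(z.re * w.im - z.im * w.re)) * h

lemma dot_shearRot {ω : ℂ} (hω : ‖ω‖ = 1) (t : ℝ) (z w : ℂ) :
    dot (shearRot ω t z) (shearRot ω t w) =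
      dot z w + t * (z.im * w.re + w.im * z.re) + t ^ 2 * (z.im * w.im) := by
  have h := Complex.sq_norm ω
  rw [hω, Complex.normSq_apply] at h
  simp only [dot, shearRot, Complex.mul_re, Complex.mul_im, Complex.add_re, Complex.add_im,
    Complex.ofReal_re, Complex.ofReal_im]
  linear_combination (-((z.re + t * z.im) * (w.re + t * w.im) + z.im * w.im)) * h

lemma cross_sq_add_dot_sq (z w : ℂ) : cross z w ^ 2 + dot z w ^ 2 = (‖z‖ * ‖w‖) ^ 2 := by
  rw [mul_pow, Complex.sq_norm, Complex.sq_norm, Complex.normSq_apply, Complex.normSq_apply, cross,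
    dot]
  ring

lemma AcutePair.left_ne {z w : ℂ} (h : AcutePair z w) : z ≠ 0 := by
  rintro rfl
  simpa [cross] using h.1

lemma AcutePair.right_ne {z w : ℂ} (h : AcutePair z w) : w ≠ 0 := by
  rintro rfl
  simpa [cross] using h.1

lemma le_norm_shearRot {ω : ℂ} (hω : ‖ω‖ = 1) (t : ℝ) (z : ℂ) :
    (1 - |t|) * ‖z‖ ≤ ‖shearRot ω t z‖ := by
  rw [shearRot, norm_mul, hω, one_mul]
  have h1 : ‖((t * z.im : ℝ) : ℂ)‖ ≤ |t| * ‖z‖ := by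
    rw [Complex.norm_real, Real.norm_eq_abs, abs_mul]
    gcongr
    exact Complex.abs_im_le_norm z
  have h2 := norm_sub_norm_le z (-((t * z.im : ℝ) : ℂ))
  rw [norm_neg, sub_neg_eq_add] at h2
  linarith

lemma AcutePair.shearRot {ω : ℂ} (hω : ‖ω‖ = 1) {t : ℝ} (ht : |t| ≤ 1 / 32) {z w : ℂ}
    (h : AcutePair z w) (hs : sinAngle z w ≤ 1 / 2) :
    AcutePair (_root_.shearRot ω t z) (_root_.shearRot ω t w) ∧
      sinAngle (_root_.shearRot ω t z) (_root_.shearRot ω t w) ≤ 2 * sinAngle z w := by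
  have hz : 0 < ‖z‖ := norm_pos_iff.2 h.left_ne
  have hw : 0 < ‖w‖ := norm_pos_iff.2 h.right_ne
  have hP : 0 < ‖z‖ * ‖w‖ := mul_pos hz hw
  have hcr : cross z w ≤ ‖z‖ * ‖w‖ / 2 := by
    rw [sinAngle, div_le_iff₀ hP] at hs
    linarith
  refine ⟨⟨by rw [cross_shearRot hω]; exact h.1, ?_⟩, ?_⟩
  · rw [dot_shearRot hω]
    have hd : ‖z‖ * ‖w‖ / 2 ≤ dot z w := by
      have h0 := cross_sq_add_dot_sq z w
      have h1 : cross z w ^ 2 ≤ (‖z‖ * ‖w‖ / 2) ^ 2 := pow_le_pow_left₀ h.1.le hcr 2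
      refine le_of_sq_le_sq ?_ h.2.le
      nlinarith
    have hzr := Complex.abs_re_le_norm z
    have hzi := Complex.abs_im_le_norm z
    have hwr := Complex.abs_re_le_norm w
    have hwi := Complex.abs_im_le_norm w
    have e1 : |z.im * w.re + w.im * z.re| ≤ 2 * (‖z‖ * ‖w‖) := by
      calc _ ≤ |z.im| * |w.re| + |w.im| * |z.re| := by
            rw [← abs_mul, ← abs_mul]; exact abs_add_le _ _
        _ ≤ ‖z‖ * ‖w‖ + ‖w‖ * ‖z‖ := by gcongr
        _ = _ := by ring
    have e2 : |z.im * w.im| ≤ ‖z‖ * ‖w‖ := by rw [abs_mul]; gcongr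
    have f1 : |t * (z.im * w.re + w.im * z.re)| ≤ 1 / 32 * (2 * (‖z‖ * ‖w‖)) := by
      rw [abs_mul]; gcongr
    have f2 : |t ^ 2 * (z.im * w.im)| ≤ (1 / 32) ^ 2 * (‖z‖ * ‖w‖) := by
      rw [abs_mul, abs_pow]; gcongr
    linarith [(abs_le.1 f1).1, (abs_le.1 f2).1]
  · have hz' := le_norm_shearRot hω t z
    have hw' := le_norm_shearRot hω t w
    rw [sinAngle, sinAngle, cross_shearRot hω, ← mul_div_assoc, div_le_div_iff₀ ?_ hP]
    · have hprod : (31 / 32 * ‖z‖) * (31 / 32 * ‖w‖) ≤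
          ‖_root_.shearRot ω t z‖ * ‖_root_.shearRot ω t w‖ := by
        gcongr
        · exact (mul_le_mul_of_nonneg_right (by linarith) hz.le).trans hz'
        · exact (mul_le_mul_of_nonneg_right (by linarith) hw.le).trans hw'
      nlinarith [mul_le_mul_of_nonneg_left hprod h.1.le, mul_pos h.1 hP]
    · exact mul_pos (lt_of_lt_of_le (mul_pos (by linarith) hz) hz')
        (lt_of_lt_of_le (mul_pos (by linarith) hw) hw')

/-- The potential of a cone: comparable to or larger than `sinAngle ^ (1 - η)`, and averaging down
under a random `shearRot`. -/
def conePotential (η β : ℝ) (a b z w : ℂ) : ℝ :=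
  cross z w ^ (1 - η) * ((potential η β a b z + potential η β a b w) / 2)

lemma sinAngle_rpow_le_conePotential {η β S : ℝ} {a b : ℂ} (hab : ‖a‖ + ‖b‖ ≤ S)
    (hβS : β ^ 2 * S ≤ 1 / 2) {z w : ℂ} (h : AcutePair z w) :
    sinAngle z w ^ (1 - η) / 2 ≤ conePotential η β a b z w := by
  have hz := (potential_bounds (η := η) hab hβS z).1
  have hw := (potential_bounds (η := η) hab hβS w).1
  have e : ∀ v : ℂ, (‖v‖ ^ 2) ^ (η - 1) = (‖v‖ ^ (η - 1)) ^ 2 := fun v => by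
    rw [sq, sq, Real.mul_rpow (norm_nonneg _) (norm_nonneg _)]
  rw [e] at hz hw
  have hc : 0 ≤ cross z w ^ (1 - η) := Real.rpow_nonneg h.1.le _
  have hs : sinAngle z w ^ (1 - η) =
      cross z w ^ (1 - η) * (‖z‖ ^ (η - 1) * ‖w‖ ^ (η - 1)) := by
    rw [sinAngle, div_eq_mul_inv, Real.mul_rpow h.1.le (by positivity), Real.inv_rpow (by positivity),
      ← Real.rpow_neg (by positivity), neg_sub, Real.mul_rpow (norm_nonneg _) (norm_nonneg _)]
  rw [hs, conePotential, mul_div_assoc]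
  gcongr
  linarith [sq_nonneg (‖z‖ ^ (η - 1) - ‖w‖ ^ (η - 1))]

/-- Optional stopping for a random walk of cones, in deterministic form. -/
theorem le_add_conePotential {ω a₀ b₀ : ℂ} (hω : ‖ω‖ = 1) (ha₀ : a₀ * (ω ^ 2 - 1) = -1 / 2)
    (hb₀ : b₀ * (ω ^ 4 - 1) = 1 / 2) {η β : ℝ} (hη : 0 < η)
    (hη' : η ≤ 1 / 32) (hβ : 0 < β) (hβη : 32 * (17 + 20 * (‖a₀‖ + ‖b₀‖)) * β ≤ η)
    {V : ℂ → ℂ → ℝ} (hV1 : ∀ z w, V z w ≤ 1)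
    (hV : ∀ z w, V z w = (V (shearRot ω β z) (shearRot ω β w) +
      V (shearRot ω (-β) z) (shearRot ω (-β) w)) / 2)
    {lo up m c : ℝ} (hlo : 0 < lo) (hup : 2 * up ≤ 1) (hm : 0 ≤ m) (hc : 0 ≤ c)
    (hVlo : ∀ z w, AcutePair z w → sinAngle z w ≤ lo → V z w ≤ m)
    (hVup : ∀ z w, AcutePair z w → up ≤ sinAngle z w → sinAngle z w ≤ 2 * up →
      V z w ≤ c * sinAngle z w ^ (1 - η))
    {z w : ℂ} (h : AcutePair z w) (hs : sinAngle z w ≤ 2 * up) :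
    V z w ≤ m + 2 * c *
      conePotential η β ((1 - η : ℝ) * a₀) ((1 - η - η / 8 : ℝ) * b₀) z w := by
  set S := ‖a₀‖ + ‖b₀‖ with hS
  have hS0 : 0 ≤ S := by positivity
  have hSβ0 : 0 ≤ S * β := by positivity
  have hβ' : β ≤ 1 / 32 := by linarith
  have hβS : β ^ 2 * S ≤ 1 / 2 := by
    calc β ^ 2 * S = β * (S * β) := by ring
      _ ≤ (1 / 2) * 1 := by gcongr <;> linarith
      _ = 1 / 2 := mul_one _
  set a : ℂ := (1 - η : ℝ) * a₀ with ha
  set b : ℂ := (1 - η - η / 8 : ℝ) * b₀ with hb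
  have hab : ‖a‖ + ‖b‖ ≤ S := by
    rw [norm_mul, norm_mul, Complex.norm_of_nonneg (by linarith),
      Complex.norm_of_nonneg (by linarith)]
    nlinarith [norm_nonneg a₀, norm_nonneg b₀]
  have hpos : ∀ z w, AcutePair z w → 0 ≤ conePotential η β a b z w := fun z w h =>
    le_trans (div_nonneg (Real.rpow_nonneg (div_nonneg h.1.le (by positivity)) _) (by norm_num))
      (sinAngle_rpow_le_conePotential hab hβS h)
  set g := lo ^ (1 - η) / 2 with hg
  have hg0 : 0 < g := by positivity
  set ρ := 1 - β ^ 2 * η / 64 with hρ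
  have hβη2 : β ^ 2 * η ≤ 1 * 1 := by
    gcongr
    · exact pow_le_one₀ hβ.le (by linarith)
    · linarith
  have hρ0 : 0 ≤ ρ := by linarith
  have hρ1 : ρ < 1 := by
    have : 0 < β ^ 2 * η := by positivity
    linarith
  have key : ∀ n : ℕ, ∀ z w, AcutePair z w → sinAngle z w ≤ 2 * up →
      V z w ≤ m + (2 * c + ρ ^ n / g) * conePotential η β a b z w := by
    intro n
    induction n with
    | zero =>
      intro z w h hs
      have hG := hpos z w h
      rcases le_total (sinAngle z w) lo with h1 | h1
      · have : 0 ≤ (2 * c + ρ ^ 0 / g) * conePotential η β a b z w := by positivity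
        linarith [hVlo z w h h1]
      · have h2 : g ≤ conePotential η β a b z w := by
          refine le_trans ?_ (sinAngle_rpow_le_conePotential hab hβS h)
          rw [hg]
          gcongr
          linarith
        have h3 : 1 ≤ ρ ^ 0 / g * conePotential η β a b z w := by
          rw [pow_zero, one_div, inv_mul_eq_div, le_div_iff₀ hg0]
          linarith
        have h4 : 0 ≤ 2 * c * conePotential η β a b z w := by positivity
        linarith [hV1 z w]
    | succ n ih =>
      intro z w h hs
      have hG := hpos z w h
      rcases le_total (sinAngle z w) lo with h1 | h1
      · have : 0 ≤ (2 * c + ρ ^ (n + 1) / g) * conePotential η β a b z w := by positivity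
        linarith [hVlo z w h h1]
      rcases le_total up (sinAngle z w) with h2 | h2
      · have h3 := hVup z w h h2 hs
        have h4 := mul_le_mul_of_nonneg_left
          (sinAngle_rpow_le_conePotential (η := η) hab hβS h) hc
        have : 0 ≤ ρ ^ (n + 1) / g * conePotential η β a b z w := by positivity
        linarith
      · obtain ⟨hp, hps⟩ := h.shearRot hω (t := β) (by rw [abs_of_pos hβ]; exact hβ')
          (by linarith)
        obtain ⟨hq, hqs⟩ := h.shearRot hω (t := -β)
          (by rw [abs_neg, abs_of_pos hβ]; exact hβ') (by linarith)
        have i1 := ih _ _ hp (by linarith)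
        have i2 := ih _ _ hq (by linarith)
        have hz := avg_potential_le hω ha₀ hb₀ hη hη' hβ hβη h.left_ne
        have hw := avg_potential_le hω ha₀ hb₀ hη hη' hβ hβη h.right_ne
        rw [← ha, ← hb, ← hρ] at hz hw
        have hcr : 0 ≤ cross z w ^ (1 - η) := Real.rpow_nonneg h.1.le _
        have havg : (conePotential η β a b (shearRot ω β z) (shearRot ω β w) +
            conePotential η β a b (shearRot ω (-β) z) (shearRot ω (-β) w)) / 2 ≤
            ρ * conePotential η β a b z w := by
          rw [conePotential, conePotential, conePotential, cross_shearRot hω, cross_shearRot hω]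
          linarith [mul_le_mul_of_nonneg_left hz hcr, mul_le_mul_of_nonneg_left hw hcr]
        have hk : 0 ≤ 2 * c + ρ ^ n / g := by positivity
        have hm1 := mul_le_mul_of_nonneg_left havg hk
        have hm2 : ρ * (2 * c * conePotential η β a b z w) ≤
            1 * (2 * c * conePotential η β a b z w) := by gcongr
        rw [hV z w]
        have hexp : (2 * c + ρ ^ n / g) * (ρ * conePotential η β a b z w) =
            ρ * (2 * c * conePotential η β a b z w) +
              ρ ^ (n + 1) / g * conePotential η β a b z w := by
          rw [pow_succ]; ring
        linarith
  have hlim : Filter.Tendsto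
      (fun n : ℕ => m + (2 * c + ρ ^ n / g) * conePotential η β a b z w) Filter.atTop
      (nhds (m + (2 * c + 0 / g) * conePotential η β a b z w)) :=
    (((((tendsto_pow_atTop_nhds_zero_of_lt_one hρ0 hρ1).div_const g).const_add _).mul_const
      _).const_add _)
  rw [zero_div, add_zero] at hlim
  exact ge_of_tendsto' hlim fun n => key n z w h hs

/-- The coordinate of the circle point `x` in which the free transfer matrix is a rotation. -/
def rotCoord (ω : ℂ) (x : AddCircle (2 * Real.pi)) : ℂ :=
  (Real.Angle.cos x : ℂ) - ω * (Real.Angle.sin x : ℂ)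

/-- The circle points whose direction lies strictly inside the cone from `z` to `w`. -/
def coneSet (ω z w : ℂ) : Set (AddCircle (2 * Real.pi)) :=
  {x | 0 < cross z (rotCoord ω x) ∧ 0 < cross (rotCoord ω x) w}

lemma rotCoord_coe (ω : ℂ) (θ : ℝ) :
    rotCoord ω (θ : AddCircle (2 * Real.pi)) = (Real.cos θ : ℂ) - ω * (Real.sin θ : ℂ) := rfl

lemma measurableSet_coneSet (ω z w : ℂ) : MeasurableSet (coneSet ω z w) := by
  have hc : Continuous (rotCoord ω) :=
    (Complex.continuous_ofReal.comp Real.Angle.continuous_cos).sub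
      (continuous_const.mul (Complex.continuous_ofReal.comp Real.Angle.continuous_sin))
  have hr := Complex.continuous_re.comp hc
  have hi := Complex.continuous_im.comp hc
  have h1 : Continuous fun x => cross z (rotCoord ω x) :=
    (continuous_const.mul hi).sub (continuous_const.mul hr)
  have h2 : Continuous fun x => cross (rotCoord ω x) w :=
    (hr.mul continuous_const).sub (hi.mul continuous_const)
  exact ((isOpen_lt continuous_const h1).inter (isOpen_lt continuous_const h2)).measurableSet

lemma cross_smul_right (r : ℝ) (z w : ℂ) : cross z (r * w) = r * cross z w := by
  simp only [cross, Complex.re_ofReal_mul, Complex.im_ofReal_mul]; ring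

lemma cross_smul_left (r : ℝ) (z w : ℂ) : cross (r * z) w = r * cross z w := by
  simp only [cross, Complex.re_ofReal_mul, Complex.im_ofReal_mul]; ring

lemma dot_smul_right (r : ℝ) (z w : ℂ) : dot z (r * w) = r * dot z w := by
  simp only [dot, Complex.re_ofReal_mul, Complex.im_ofReal_mul]; ring

lemma dot_smul_left (r : ℝ) (z w : ℂ) : dot (r * z) w = r * dot z w := by
  simp only [dot, Complex.re_ofReal_mul, Complex.im_ofReal_mul]; ring

lemma shearRot_rotCoord_tauMap {e σ : ℝ} (hσ : 0 < σ) (heσ : e ^ 2 + σ ^ 2 = 1) (lam ε : ℝ)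
    (x : AddCircle (2 * Real.pi)) :
    ∃ r : ℝ, 0 < r ∧
      shearRot ⟨e, -σ⟩ (lam * ε / σ) (rotCoord ⟨e, -σ⟩ (tauMap (gE lam (2 * e) ε) x)) =
        r * rotCoord ⟨e, -σ⟩ x := by
  have hx : x ∈ ((↑) : ℝ → AddCircle (2 * Real.pi)) '' Set.Ico 0 (0 + 2 * Real.pi) := by
    rw [AddCircle.coe_image_Ico_eq]; trivial
  obtain ⟨θ, hθ, rfl⟩ := hx
  have hτ : tauMap (gE lam (2 * e) ε) (θ : AddCircle (2 * Real.pi)) =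
      tauC (gE lam (2 * e) ε) θ := AddCircle.liftIco_coe_apply hθ
  rw [hτ]
  set p := (2 * e - lam * ε) * Real.cos θ - Real.sin θ with hp
  set m : ℂ := ⟨p, Real.cos θ⟩ with hm
  have htau : tauC (gE lam (2 * e) ε) θ = ((Complex.arg m : ℝ) : AddCircle (2 * Real.pi)) := by
    rw [tauC]
    congr 2
    apply Complex.ext <;> simp [gE, hm, hp, -Complex.ofReal_cos, -Complex.ofReal_sin]
    ring
  have hm0 : m ≠ 0 := by
    intro h
    have h1 : Real.cos θ = 0 := congrArg Complex.im h
    have h2 : p = 0 := congrArg Complex.re h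
    have h3 := Real.sin_sq_add_cos_sq θ
    rw [hp, h1] at h2
    rw [h1] at h3
    nlinarith
  have hn : 0 < ‖m‖ := norm_pos_iff.2 hm0
  refine ⟨‖m‖⁻¹, inv_pos.2 hn, ?_⟩
  rw [htau, rotCoord_coe, rotCoord_coe, Complex.cos_arg hm0, Complex.sin_arg]
  have hre : m.re = p := rfl
  have him : m.im = Real.cos θ := rfl
  rw [hre, him]
  apply Complex.ext
  · simp [shearRot, -Complex.ofReal_cos, -Complex.ofReal_sin]
    field_simp
    rw [hp]
    linear_combination Real.cos θ * heσ
  · simp [shearRot, -Complex.ofReal_cos, -Complex.ofReal_sin]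
    field_simp
    rw [hp]
    ring

lemma norm_mk_neg {e σ : ℝ} (heσ : e ^ 2 + σ ^ 2 = 1) : ‖(⟨e, -σ⟩ : ℂ)‖ = 1 := by
  rw [← sq_eq_sq₀ (norm_nonneg _) zero_le_one, Complex.sq_norm, Complex.normSq_mk]
  linarith

lemma preimage_coneSet {e σ : ℝ} (hσ : 0 < σ) (heσ : e ^ 2 + σ ^ 2 = 1) (lam ε : ℝ) (z w : ℂ) :
    tauMap (gE lam (2 * e) ε) ⁻¹' coneSet ⟨e, -σ⟩ z w =
      coneSet ⟨e, -σ⟩ (shearRot ⟨e, -σ⟩ (lam * ε / σ) z) (shearRot ⟨e, -σ⟩ (lam * ε / σ) w) := by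
  ext x
  obtain ⟨r, hr, h⟩ := shearRot_rotCoord_tauMap hσ heσ lam ε x
  have hω := norm_mk_neg heσ
  simp only [coneSet, Set.mem_preimage, Set.mem_ofPred_eq]
  rw [← cross_shearRot hω (lam * ε / σ) z, ← cross_shearRot hω (lam * ε / σ) _ w, h,
    cross_smul_right, cross_smul_left, mul_pos_iff_of_pos_left hr, mul_pos_iff_of_pos_left hr]

lemma real_coneSet_eq_of_stationary {e σ : ℝ} (hσ : 0 < σ) (heσ : e ^ 2 + σ ^ 2 = 1) {lam : ℝ}
    {ν : Measure (AddCircle (2 * Real.pi))} [IsProbabilityMeasure ν]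
    (hν : Stationary lam (2 * e) ν) (z w : ℂ) :
    ν.real (coneSet ⟨e, -σ⟩ z w) =
      (ν.real (coneSet ⟨e, -σ⟩ (shearRot ⟨e, -σ⟩ (lam / σ) z) (shearRot ⟨e, -σ⟩ (lam / σ) w)) +
        ν.real (coneSet ⟨e, -σ⟩ (shearRot ⟨e, -σ⟩ (-(lam / σ)) z)
          (shearRot ⟨e, -σ⟩ (-(lam / σ)) w))) / 2 := by
  have h := hν _ (measurableSet_coneSet ⟨e, -σ⟩ z w)
  rw [preimage_coneSet hσ heσ, preimage_coneSet hσ heσ] at h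
  rw [mul_one, mul_neg_one, neg_div] at h
  rw [Measure.real, h, ENNReal.toReal_div,
    ENNReal.toReal_add (measure_ne_top _ _) (measure_ne_top _ _)]
  rfl

lemma cross_rotCoord (e σ θ φ : ℝ) :
    cross (rotCoord ⟨e, -σ⟩ (θ : AddCircle (2 * Real.pi)))
      (rotCoord ⟨e, -σ⟩ (φ : AddCircle (2 * Real.pi))) = σ * Real.sin (φ - θ) := by
  rw [rotCoord_coe, rotCoord_coe, Real.sin_sub]
  simp [cross, -Complex.ofReal_cos, -Complex.ofReal_sin]
  ring

lemma dot_rotCoord {e σ : ℝ} (heσ : e ^ 2 + σ ^ 2 = 1) (θ φ : ℝ) :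
    dot (rotCoord ⟨e, -σ⟩ (θ : AddCircle (2 * Real.pi)))
      (rotCoord ⟨e, -σ⟩ (φ : AddCircle (2 * Real.pi))) =
        Real.cos (φ - θ) - e * Real.sin (θ + φ) := by
  rw [rotCoord_coe, rotCoord_coe, Real.cos_sub, Real.sin_add]
  simp [dot, -Complex.ofReal_cos, -Complex.ofReal_sin]
  linear_combination (Real.sin θ * Real.sin φ) * heσ

lemma norm_sq_eq_dot (z : ℂ) : ‖z‖ ^ 2 = dot z z := by
  rw [Complex.sq_norm, Complex.normSq_apply, dot]

lemma abs_mul_sin_le (e x : ℝ) : |e * Real.sin x| ≤ |e| := by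
  rw [abs_mul]
  exact mul_le_of_le_one_right (abs_nonneg _) (Real.abs_sin_le_one x)

lemma norm_sq_rotCoord_bounds {e σ : ℝ} (heσ : e ^ 2 + σ ^ 2 = 1) (θ : ℝ) :
    1 - |e| ≤ ‖rotCoord ⟨e, -σ⟩ (θ : AddCircle (2 * Real.pi))‖ ^ 2 ∧
      ‖rotCoord ⟨e, -σ⟩ (θ : AddCircle (2 * Real.pi))‖ ^ 2 ≤ 2 := by
  rw [norm_sq_eq_dot, dot_rotCoord heσ, sub_self, Real.cos_zero]
  have h := abs_le.1 (abs_mul_sin_le e (θ + θ))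
  have he : |e| ≤ 1 := by
    rw [abs_le_one_iff_mul_self_le_one]
    nlinarith [sq_nonneg σ]
  constructor <;> linarith

lemma arc_subset_coneSet {e σ : ℝ} (hσ : 0 < σ) {a l : ℝ} (hl : l ≤ Real.pi) :
    arc a l ⊆ coneSet ⟨e, -σ⟩ (rotCoord ⟨e, -σ⟩ (a : AddCircle (2 * Real.pi)))
      (rotCoord ⟨e, -σ⟩ ((a + l : ℝ) : AddCircle (2 * Real.pi))) := by
  rintro _ ⟨θ, ⟨h1, h2⟩, rfl⟩
  constructor
  · rw [cross_rotCoord]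
    exact mul_pos hσ (Real.sin_pos_of_pos_of_lt_pi (by linarith) (by linarith))
  · rw [cross_rotCoord]
    exact mul_pos hσ (Real.sin_pos_of_pos_of_lt_pi (by linarith) (by linarith))

lemma exists_eq_mul_rotCoord {e σ : ℝ} (hσ : 0 < σ) (θ : ℝ) {w : ℂ} (hw : w ≠ 0) :
    ∃ r ℓ : ℝ, 0 < r ∧ -Real.pi < ℓ ∧ ℓ ≤ Real.pi ∧
      w = r * rotCoord ⟨e, -σ⟩ ((θ + ℓ : ℝ) : AddCircle (2 * Real.pi)) := by
  set v : ℂ := ⟨w.re + e / σ * w.im, w.im / σ⟩ with hv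
  have hv0 : v ≠ 0 := by
    intro h
    have h1 : w.im / σ = 0 := congrArg Complex.im h
    have h2 : w.re + e / σ * w.im = 0 := congrArg Complex.re h
    have h3 : w.im = 0 := by simpa [hσ.ne'] using h1
    rw [h3, mul_zero, add_zero] at h2
    exact hw (Complex.ext h2 h3)
  set q : ℂ := v * Complex.exp (-(θ * Complex.I)) with hq
  have hvq : v = ‖q‖ * Complex.exp (((θ + q.arg : ℝ) : ℂ) * Complex.I) := by
    have h1 : v = q * Complex.exp (θ * Complex.I) := by
      rw [hq, mul_assoc, ← Complex.exp_add, neg_add_cancel, Complex.exp_zero, mul_one]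
    rw [h1]
    conv_lhs => rw [← Complex.norm_mul_exp_arg_mul_I q]
    rw [mul_assoc, ← Complex.exp_add]
    push_cast
    ring_nf
  refine ⟨‖q‖, q.arg, norm_pos_iff.2 (mul_ne_zero hv0 (Complex.exp_ne_zero _)),
    Complex.neg_pi_lt_arg q, Complex.arg_le_pi q, ?_⟩
  have hre : v.re = ‖q‖ * Real.cos (θ + q.arg) := by
    conv_lhs => rw [hvq]
    rw [Complex.re_ofReal_mul, Complex.exp_ofReal_mul_I_re]
  have him : v.im = ‖q‖ * Real.sin (θ + q.arg) := by
    conv_lhs => rw [hvq]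
    rw [Complex.im_ofReal_mul, Complex.exp_ofReal_mul_I_im]
  have hre' : v.re = w.re + e / σ * w.im := rfl
  have him' : v.im = w.im / σ := rfl
  rw [hre'] at hre
  rw [him'] at him
  rw [rotCoord_coe]
  apply Complex.ext
  · simp [-Complex.ofReal_cos, -Complex.ofReal_sin, -Complex.ofReal_add]
    linear_combination hre - e * him
  · simp [-Complex.ofReal_cos, -Complex.ofReal_sin, -Complex.ofReal_add]
    rw [div_eq_iff hσ.ne'] at him
    linear_combination him

lemma coneSet_subset_arc {e σ : ℝ} (hσ : 0 < σ) {a ℓ r s : ℝ} (hr : 0 < r) (hs : 0 < s)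
    (hℓ : 0 ≤ ℓ) :
    coneSet ⟨e, -σ⟩ (r * rotCoord ⟨e, -σ⟩ (a : AddCircle (2 * Real.pi)))
      (s * rotCoord ⟨e, -σ⟩ ((a + ℓ : ℝ) : AddCircle (2 * Real.pi))) ⊆ arc a ℓ := by
  intro x hx
  have hmem : x ∈ ((↑) : ℝ → AddCircle (2 * Real.pi)) '' Set.Ico a (a + 2 * Real.pi) := by
    rw [AddCircle.coe_image_Ico_eq]; trivial
  obtain ⟨θ, ⟨hθ1, hθ2⟩, rfl⟩ := hmem
  obtain ⟨h1, h2⟩ := hx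
  rw [cross_smul_left, cross_rotCoord, mul_pos_iff_of_pos_left hr,
    mul_pos_iff_of_pos_left hσ] at h1
  rw [cross_smul_right, cross_rotCoord, mul_pos_iff_of_pos_left hs,
    mul_pos_iff_of_pos_left hσ] at h2
  have h3 : θ - a < Real.pi := by
    by_contra! hc
    have h4 := Real.sin_nonneg_of_nonneg_of_le_pi (by linarith : 0 ≤ θ - a - Real.pi)
      (by linarith)
    rw [Real.sin_sub_pi] at h4
    linarith
  refine ⟨θ, ⟨lt_of_le_of_ne hθ1 ?_, ?_⟩, rfl⟩
  · rintro rfl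
    simp at h1
  · by_contra! hc
    linarith [Real.sin_nonpos_of_nonpos_of_neg_pi_le (by linarith : a + ℓ - θ ≤ 0) (by linarith)]

lemma exists_coneSet_subset_arc {e σ : ℝ} (he : |e| < 1) (hσ : 0 < σ) (heσ : e ^ 2 + σ ^ 2 = 1)
    {z w : ℂ} (h : AcutePair z w) (hs : sinAngle z w ≤ (1 - |e|) * σ / 4) :
    ∃ a ℓ : ℝ, ℓ < 4 / σ * sinAngle z w ∧ coneSet ⟨e, -σ⟩ z w ⊆ arc a ℓ := by
  obtain ⟨r, a, hr, -, -, hz⟩ := exists_eq_mul_rotCoord (e := e) hσ 0 h.left_ne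
  obtain ⟨s, ℓ, hs0, hℓ1, hℓ2, hw⟩ := exists_eq_mul_rotCoord (e := e) hσ (0 + a) h.right_ne
  set a' := 0 + a
  have hcr : cross z w = r * (s * (σ * Real.sin ℓ)) := by
    rw [hz, hw, cross_smul_left, cross_smul_right, cross_rotCoord, add_sub_cancel_left]
  have hdot : dot z w = r * (s * (Real.cos ℓ - e * Real.sin (a' + (a' + ℓ)))) := by
    rw [hz, hw, dot_smul_left, dot_smul_right, dot_rotCoord heσ, add_sub_cancel_left]
  obtain ⟨hc0, hd0⟩ := h
  have hsin : 0 < Real.sin ℓ := by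
    rw [hcr, mul_pos_iff_of_pos_left hr, mul_pos_iff_of_pos_left hs0,
      mul_pos_iff_of_pos_left hσ] at hc0
    exact hc0
  rw [hdot, mul_pos_iff_of_pos_left hr, mul_pos_iff_of_pos_left hs0] at hd0
  have hℓ0 : 0 < ℓ := by
    by_contra! hc
    linarith [Real.sin_nonpos_of_nonpos_of_neg_pi_le hc hℓ1.le]
  have hsa : σ * Real.sin ℓ ≤ 2 * sinAngle z w := by
    have n1 := (norm_sq_rotCoord_bounds heσ a').2
    have n2 := (norm_sq_rotCoord_bounds heσ (a' + ℓ)).2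
    have n1' := (norm_sq_rotCoord_bounds heσ a').1
    have n2' := (norm_sq_rotCoord_bounds heσ (a' + ℓ)).1
    have hnz : ‖z‖ = r * ‖rotCoord ⟨e, -σ⟩ (a' : AddCircle (2 * Real.pi))‖ := by
      rw [hz, norm_mul, Complex.norm_of_nonneg hr.le]
    have hnw : ‖w‖ = s * ‖rotCoord ⟨e, -σ⟩ ((a' + ℓ : ℝ) : AddCircle (2 * Real.pi))‖ := by
      rw [hw, norm_mul, Complex.norm_of_nonneg hs0.le]
    set A := ‖rotCoord ⟨e, -σ⟩ (a' : AddCircle (2 * Real.pi))‖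
    set B := ‖rotCoord ⟨e, -σ⟩ ((a' + ℓ : ℝ) : AddCircle (2 * Real.pi))‖
    have hA0 : 0 ≤ A := norm_nonneg _
    have hB0 : 0 ≤ B := norm_nonneg _
    have hA : 0 < A := lt_of_le_of_ne hA0 (by rintro h; rw [← h] at n1'; norm_num at n1'; linarith)
    have hB : 0 < B := lt_of_le_of_ne hB0 (by rintro h; rw [← h] at n2'; norm_num at n2'; linarith)
    have hAB : A * B ≤ 2 := by nlinarith [sq_nonneg (A - B)]
    have hσs : 0 < σ * Real.sin ℓ := mul_pos hσ hsin
    rw [sinAngle, hcr, hnz, hnw, ← mul_div_assoc, le_div_iff₀ (by positivity)]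
    have := mul_le_mul_of_nonneg_left hAB (mul_pos (mul_pos hr hs0) hσs).le
    linarith
  have hsmall : Real.sin ℓ ≤ (1 - |e|) / 2 := by
    have : σ * Real.sin ℓ ≤ σ * ((1 - |e|) / 2) := by linarith
    exact le_of_mul_le_mul_left this hσ
  have hcos : 0 < Real.cos ℓ := by
    by_contra! hc
    have e1 : Real.sin (a' + (a' + ℓ)) =
        Real.sin (a' + a') * Real.cos ℓ + Real.cos (a' + a') * Real.sin ℓ := by
      rw [← add_assoc, Real.sin_add]
    have e2 := abs_le.1 (abs_mul_sin_le e (a' + a'))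
    have e3 : |e * Real.cos (a' + a')| ≤ 1 := by
      rw [abs_mul]
      exact mul_le_one₀ he.le (abs_nonneg _) (Real.abs_cos_le_one _)
    have e4 := mul_le_mul_of_nonpos_right
      (by linarith : 1 - |e| ≤ 1 - e * Real.sin (a' + a')) hc
    have e5 := mul_le_mul_of_nonneg_right (neg_le_of_abs_le e3) hsin.le
    rw [e1] at hd0
    have e6 : (1 - |e|) * (-Real.cos ℓ) < Real.sin ℓ := by linarith
    have e7 : (1 - |e|) * (-Real.cos ℓ) < (1 - |e|) * (1 / 2) := by linarith
    have e8 := lt_of_mul_lt_mul_left e7 (by linarith)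
    have e9 : Real.sin ℓ ≤ 1 / 2 := by linarith [abs_nonneg e]
    nlinarith [Real.sin_sq_add_cos_sq ℓ]
  have hhalf : ℓ ≤ Real.pi / 2 := by
    by_contra! hc
    linarith [Real.cos_nonpos_of_pi_div_two_le_of_le hc.le (by linarith [Real.pi_pos])]
  refine ⟨a', ℓ, ?_, ?_⟩
  · have hj := Real.mul_le_sin hℓ0.le hhalf
    rw [div_mul_eq_mul_div, div_le_iff₀ Real.pi_pos] at hj
    have hlt : 2 * ℓ < Real.sin ℓ * 4 :=
      hj.trans_lt (mul_lt_mul_of_pos_left Real.pi_lt_four hsin)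
    rw [div_mul_eq_mul_div, lt_div_iff₀ hσ]
    nlinarith
  · rw [hz, hw]
    exact coneSet_subset_arc hσ hr hs0 hℓ0.le

lemma acutePair_rotCoord {e σ : ℝ} (he : |e| < 1) (hσ : 0 < σ) (heσ : e ^ 2 + σ ^ 2 = 1)
    {a l : ℝ} (hl : 0 < l) (hl' : l < (1 - |e|) / 2) :
    AcutePair (rotCoord ⟨e, -σ⟩ (a : AddCircle (2 * Real.pi)))
      (rotCoord ⟨e, -σ⟩ ((a + l : ℝ) : AddCircle (2 * Real.pi))) := by
  have he0 := abs_nonneg e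
  have hsin := Real.sin_pos_of_pos_of_lt_pi hl (by linarith [Real.pi_gt_three])
  refine ⟨?_, ?_⟩
  · rw [cross_rotCoord, add_sub_cancel_left]
    exact mul_pos hσ hsin
  · rw [dot_rotCoord heσ, add_sub_cancel_left]
    have e1 : Real.sin (a + (a + l)) =
        Real.sin (a + a) * Real.cos l + Real.cos (a + a) * Real.sin l := by
      rw [← add_assoc, Real.sin_add]
    have e2 := abs_le.1 (abs_mul_sin_le e (a + a))
    have e3 : |e * Real.cos (a + a)| ≤ 1 := by
      rw [abs_mul]
      exact mul_le_one₀ he.le (abs_nonneg _) (Real.abs_cos_le_one _)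
    have hcos : 1 / 2 ≤ Real.cos l := by
      have := Real.one_sub_sq_div_two_le_cos (x := l)
      nlinarith
    have e4 := mul_le_mul_of_nonneg_right
      (by linarith : 1 - |e| ≤ 1 - e * Real.sin (a + a)) (by linarith : 0 ≤ Real.cos l)
    have e5 := mul_le_mul_of_nonneg_right (le_of_abs_le e3) hsin.le
    have e6 := mul_le_mul_of_nonneg_left hcos (by linarith : 0 ≤ 1 - |e|)
    have e7 := Real.sin_le hl.le
    rw [e1]
    linarith

lemma arcSupLt_le_one (ν : Measure (AddCircle (2 * Real.pi))) [IsProbabilityMeasure ν] (s : ℝ) :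
    arcSupLt ν s ≤ 1 :=
  iSup_le fun _ => iSup_le fun _ => iSup_le fun _ => prob_le_one

lemma measure_le_arcSupLt (ν : Measure (AddCircle (2 * Real.pi))) {s a l : ℝ} (h : l < s) :
    ν (arc a l) ≤ arcSupLt ν s :=
  le_iSup_of_le a (le_iSup_of_le l (le_iSup_of_le h le_rfl))

lemma real_coneSet_le_toReal_arcSupLt {e σ : ℝ} (he : |e| < 1) (hσ : 0 < σ)
    (heσ : e ^ 2 + σ ^ 2 = 1) (ν : Measure (AddCircle (2 * Real.pi))) [IsProbabilityMeasure ν]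
    {z w : ℂ} (h : AcutePair z w) (hs : sinAngle z w ≤ (1 - |e|) * σ / 4) {t : ℝ}
    (ht : 4 / σ * sinAngle z w ≤ t) :
    ν.real (coneSet ⟨e, -σ⟩ z w) ≤ (arcSupLt ν t).toReal := by
  obtain ⟨a, ℓ, hℓ, hsub⟩ := exists_coneSet_subset_arc he hσ heσ h hs
  exact ENNReal.toReal_mono (ne_top_of_le_ne_top ENNReal.one_ne_top (arcSupLt_le_one ν t))
    ((measure_mono hsub).trans (measure_le_arcSupLt ν (hℓ.trans_le ht)))

lemma exists_corrector_coeffs {e σ : ℝ} (he : e ≠ 0) (hσ : 0 < σ) :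
    ∃ a₀ b₀ : ℂ, a₀ * ((⟨e, -σ⟩ : ℂ) ^ 2 - 1) = -1 / 2 ∧
      b₀ * ((⟨e, -σ⟩ : ℂ) ^ 4 - 1) = 1 / 2 := by
  have him : ((⟨e, -σ⟩ : ℂ) ^ 2).im ≠ 0 := by
    rw [sq, Complex.mul_im]
    have : e * σ ≠ 0 := mul_ne_zero he hσ.ne'
    intro h
    apply this
    simp only at h
    linarith
  have h1 : (⟨e, -σ⟩ : ℂ) ^ 2 - 1 ≠ 0 := fun h => him (by
    have := congrArg Complex.im h
    rwa [Complex.sub_im, Complex.one_im, sub_zero] at this)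
  have h2 : (⟨e, -σ⟩ : ℂ) ^ 2 + 1 ≠ 0 := fun h => him (by
    have := congrArg Complex.im h
    rwa [Complex.add_im, Complex.one_im, add_zero] at this)
  have h3 : (⟨e, -σ⟩ : ℂ) ^ 4 - 1 ≠ 0 := by
    have : (⟨e, -σ⟩ : ℂ) ^ 4 - 1 = ((⟨e, -σ⟩ : ℂ) ^ 2 - 1) * ((⟨e, -σ⟩ : ℂ) ^ 2 + 1) := by ring
    rw [this]
    exact mul_ne_zero h1 h2
  exact ⟨-1 / 2 / _, 1 / 2 / _, div_mul_cancel₀ _ h1, div_mul_cancel₀ _ h3⟩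

lemma conePotential_rotCoord_le {e σ : ℝ} (he : |e| < 1) (hσ : 0 < σ) (heσ : e ^ 2 + σ ^ 2 = 1)
    {η β S : ℝ} {a b : ℂ} (hη : 0 < η) (hη' : η ≤ 1) (hab : ‖a‖ + ‖b‖ ≤ S)
    (hβS : β ^ 2 * S ≤ 1 / 2) (θ : ℝ) {l : ℝ} (hl : 0 < l) (hl' : l ≤ Real.pi) :
    conePotential η β a b (rotCoord ⟨e, -σ⟩ (θ : AddCircle (2 * Real.pi)))
      (rotCoord ⟨e, -σ⟩ ((θ + l : ℝ) : AddCircle (2 * Real.pi))) ≤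
      2 / (1 - |e|) * l ^ (1 - η) := by
  have hq : 0 < 1 - |e| := by linarith
  have hσ1 : σ ≤ 1 := by nlinarith [sq_nonneg e]
  have hp : ∀ φ : ℝ, potential η β a b (rotCoord ⟨e, -σ⟩ (φ : AddCircle (2 * Real.pi))) ≤
      2 / (1 - |e|) := fun φ => by
    refine (potential_bounds hab hβS _).2.trans ?_
    rw [div_eq_mul_inv, ← Real.rpow_neg_one]
    gcongr
    refine (Real.rpow_le_rpow_of_nonpos hq (norm_sq_rotCoord_bounds heσ φ).1
      (by linarith)).trans ?_
    exact Real.rpow_le_rpow_of_exponent_ge hq (by linarith [abs_nonneg e]) (by linarith)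
  rw [conePotential, cross_rotCoord, add_sub_cancel_left, mul_comm]
  have hsin := Real.sin_nonneg_of_nonneg_of_le_pi hl.le hl'
  have hle : σ * Real.sin l ≤ l := by
    calc σ * Real.sin l ≤ 1 * l := by gcongr; exact Real.sin_le hl.le
      _ = l := one_mul l
  have h1 := hp θ
  have h2 := hp (θ + l)
  have h3 : (σ * Real.sin l) ^ (1 - η) ≤ l ^ (1 - η) :=
    Real.rpow_le_rpow (by positivity) hle (by linarith)
  have h4 : 0 ≤ (σ * Real.sin l) ^ (1 - η) := by positivity
  calc _ ≤ 2 / (1 - |e|) * (σ * Real.sin l) ^ (1 - η) :=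
      mul_le_mul_of_nonneg_right (by linarith) h4
    _ ≤ _ := by gcongr

lemma le_three_mul_rpow {s r : ℝ} (hs : 0 < s) (hs' : s ≤ 1 / 2) (hr : 0 < r)
    (hrs : r ≤ (s⁻¹) ^ 2) : r ≤ 3 * r ^ (1 - s ^ 5) := by
  have h1 : r ≤ Real.exp (2 * s⁻¹) := by
    refine hrs.trans ?_
    rw [two_mul, Real.exp_add, ← sq]
    have := Real.add_one_le_exp s⁻¹
    gcongr
    linarith
  have h2 : r ^ (s ^ 5) ≤ 3 := by
    calc r ^ (s ^ 5) ≤ Real.exp (2 * s⁻¹) ^ (s ^ 5) := by gcongr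
      _ = Real.exp (2 * s ^ 4) := by
        rw [← Real.exp_mul]
        congr 1
        field_simp
      _ ≤ Real.exp 1 := by
        have : s ^ 4 ≤ (1 / 2) ^ 4 := by gcongr
        gcongr
        linarith
      _ ≤ 3 := by linarith [Real.exp_one_lt_d9]
  calc r = r ^ (s ^ 5) * r ^ (1 - s ^ 5) := by
        rw [← Real.rpow_add hr, add_sub_cancel, Real.rpow_one]
    _ ≤ _ := by gcongr

lemma sinAngle_rotCoord_le {e σ : ℝ} (he : |e| < 1) (hσ : 0 < σ) (heσ : e ^ 2 + σ ^ 2 = 1)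
    (θ : ℝ) {l : ℝ} (hl : 0 < l) :
    sinAngle (rotCoord ⟨e, -σ⟩ (θ : AddCircle (2 * Real.pi)))
      (rotCoord ⟨e, -σ⟩ ((θ + l : ℝ) : AddCircle (2 * Real.pi))) ≤ l / (1 - |e|) := by
  have hq : 0 < 1 - |e| := by linarith
  have hσ1 : σ ≤ 1 := by nlinarith [sq_nonneg e]
  rw [sinAngle, cross_rotCoord, add_sub_cancel_left]
  have hle : σ * Real.sin l ≤ l := by
    nlinarith [Real.sin_le hl.le, mul_le_mul_of_nonneg_left (Real.sin_le hl.le) hσ.le]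
  refine div_le_div₀ hl.le hle hq ?_
  refine le_of_sq_le_sq ?_ (by positivity)
  rw [mul_pow, sq (1 - |e|)]
  exact mul_le_mul (norm_sq_rotCoord_bounds heσ _).1 (norm_sq_rotCoord_bounds heσ _).1 hq.le
    (by positivity)

lemma conePotential_corrector_le {e σ η β l S : ℝ} {a₀ b₀ : ℂ} (he : |e| < 1) (hσ : 0 < σ)
    (heσ : e ^ 2 + σ ^ 2 = 1) (hη : 0 < η) (hη' : η ≤ 1 / 2) (hβ : 0 ≤ β)
    (hβS : 20 * β * (1 + S) ≤ 1) (hS : ‖a₀‖ + ‖b₀‖ = S) (θ : ℝ) (hl : 0 < l)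
    (hl' : l ≤ Real.pi) :
    conePotential η β ((1 - η : ℝ) * a₀) ((1 - η - η / 8 : ℝ) * b₀)
      (rotCoord ⟨e, -σ⟩ (θ : AddCircle (2 * Real.pi)))
      (rotCoord ⟨e, -σ⟩ ((θ + l : ℝ) : AddCircle (2 * Real.pi))) ≤
      2 / (1 - |e|) * l ^ (1 - η) := by
  have hS0 : 0 ≤ S := by rw [← hS]; positivity
  have hβS0 : 0 ≤ β * S := by positivity
  refine conePotential_rotCoord_le he hσ heσ hη (by linarith) (S := S) ?_ ?_ θ hl hl'
  · rw [norm_mul, norm_mul, Complex.norm_of_nonneg (by linarith),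
      Complex.norm_of_nonneg (by linarith), ← hS]
    nlinarith [norm_nonneg a₀, norm_nonneg b₀]
  · calc β ^ 2 * S = β * (β * S) := by ring
      _ ≤ 1 * (1 / 2) := by gcongr <;> linarith
      _ = 1 / 2 := one_mul _

lemma real_arc_le {e σ s lam l S M : ℝ} {a₀ b₀ : ℂ} (he : |e| < 1) (hσ : 0 < σ)
    (heσ : e ^ 2 + σ ^ 2 = 1) (ha₀ : a₀ * ((⟨e, -σ⟩ : ℂ) ^ 2 - 1) = -1 / 2)
    (hb₀ : b₀ * ((⟨e, -σ⟩ : ℂ) ^ 4 - 1) = 1 / 2) (hS : ‖a₀‖ + ‖b₀‖ = S)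
    (hs : 0 < s) (hs1 : s ≤ 1 / 32) (hs2 : 32 * (17 + 20 * S) * s ≤ σ)
    (hs3 : 16 * s ≤ (1 - |e|) * σ) (hlam : lam = s ^ 10) (hl : 0 < l) (hl' : l ≤ lam)
    {ν : Measure (AddCircle (2 * Real.pi))} [IsProbabilityMeasure ν]
    (hν : Stationary lam (2 * e) ν) (hM : 0 ≤ M)
    (hMD : ∀ D ∈ Set.Ioo s⁻¹ ((s⁻¹) ^ 2), (arcSupLt ν (D * l)).toReal ≤ D * M) (a : ℝ) :
    ν.real (arc a l) ≤ (arcSupLt ν (s * l)).toReal + 48 / (σ * (1 - |e|)) * M := by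
  have hq : 0 < 1 - |e| := by linarith
  have hq1 : 1 - |e| ≤ 1 := by linarith [abs_nonneg e]
  have hσ1 : σ ≤ 1 := by nlinarith [sq_nonneg e]
  have hS0 : 0 ≤ S := by rw [← hS]; positivity
  have hsq : 16 * s ≤ 1 - |e| := hs3.trans (mul_le_of_le_one_right hq.le hσ1)
  have hsσ : 16 * s ≤ σ := hs3.trans (mul_le_of_le_one_left hσ.le hq1)
  have hls : l / s ≤ s := by
    rw [div_le_iff₀ hs, ← sq]
    refine hl'.trans ?_
    rw [hlam]
    exact pow_le_pow_of_le_one hs.le (by linarith) (by norm_num)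
  have hl1 : l ≤ s := by
    have := (div_le_iff₀ hs).1 hls
    nlinarith
  have hη : 0 < s ^ 5 := by positivity
  have hη1 : s ^ 5 ≤ 1 / 32 :=
    (pow_le_of_le_one hs.le (by linarith) (by norm_num)).trans hs1
  have hβη : 32 * (17 + 20 * S) * (lam / σ) ≤ s ^ 5 := by
    rw [mul_div_assoc', div_le_iff₀ hσ, hlam]
    calc 32 * (17 + 20 * S) * s ^ 10 = 32 * (17 + 20 * S) * s * s ^ 9 := by ring
      _ ≤ σ * s ^ 9 := by gcongr
      _ ≤ σ * s ^ 5 := by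
        gcongr ?_ * ?_
        exact pow_le_pow_of_le_one hs.le (by linarith) (by norm_num)
      _ = s ^ 5 * σ := mul_comm _ _
  have hlam0 : 0 < lam := hl.trans_le hl'
  have hβ : 0 < lam / σ := by positivity
  have hβη' : 20 * (lam / σ) * (1 + S) ≤ 1 := by nlinarith
  have hlπ : l ≤ Real.pi := by linarith [Real.pi_gt_three]
  have hmain := le_add_conePotential (norm_mk_neg heσ) ha₀ hb₀ hη hη1 hβ (by rwa [hS])
    (V := fun z w => ν.real (coneSet ⟨e, -σ⟩ z w)) (fun _ _ => measureReal_le_one)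
    (real_coneSet_eq_of_stationary hσ heσ hν) (lo := s * l * σ / 4) (up := l / s)
    (m := (arcSupLt ν (s * l)).toReal) (c := 12 / σ * M / l ^ (1 - s ^ 5))
    (by positivity) (by linarith) ENNReal.toReal_nonneg (by positivity)
    (fun z w h hlo => by
      refine real_coneSet_le_toReal_arcSupLt he hσ heσ ν h ?_ ?_
      · refine hlo.trans ?_
        have : s * l ≤ 1 - |e| := by nlinarith
        nlinarith
      · calc 4 / σ * sinAngle z w ≤ 4 / σ * (s * l * σ / 4) := by gcongr
          _ = s * l := by field_simp)
    (fun z w h h1 h2 => by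
      have hpos : 0 < sinAngle z w := lt_of_lt_of_le (by positivity) h1
      have hr1 : s⁻¹ ≤ sinAngle z w / l := by
        rw [le_div_iff₀ hl]
        refine le_trans (le_of_eq ?_) h1
        ring
      have hr2 : sinAngle z w / l ≤ 2 * s⁻¹ := by
        rw [div_le_iff₀ hl]
        refine h2.trans (le_of_eq ?_)
        ring
      have hK : 4 ≤ 4 / σ := by
        rw [le_div_iff₀ hσ]
        linarith
      have hKs : 4 / σ * (2 * s⁻¹) < (s⁻¹) ^ 2 := by
        have : 8 / σ < s⁻¹ := by
          rw [div_lt_iff₀ hσ, ← div_eq_inv_mul, lt_div_iff₀ hs]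
          linarith
        calc 4 / σ * (2 * s⁻¹) = 8 / σ * s⁻¹ := by ring
          _ < s⁻¹ * s⁻¹ := by gcongr
          _ = _ := (sq _).symm
      have hinv : 0 < s⁻¹ := inv_pos.2 hs
      have hD := hMD (4 / σ * (sinAngle z w / l))
        ⟨by nlinarith, lt_of_le_of_lt (by gcongr) hKs⟩
      have hsmall : (s⁻¹ : ℝ) * 2 ≤ (s⁻¹) ^ 2 := by
        refine le_trans ?_ hKs.le
        nlinarith
      refine (real_coneSet_le_toReal_arcSupLt he hσ heσ ν h ?_ (t := 4 / σ * sinAngle z w)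
        le_rfl).trans ?_
      · refine h2.trans ?_
        linarith
      · have hE : 4 / σ * (sinAngle z w / l) * l = 4 / σ * sinAngle z w := by field_simp
        rw [hE] at hD
        refine hD.trans ?_
        calc 4 / σ * (sinAngle z w / l) * M
            ≤ 4 / σ * (3 * (sinAngle z w / l) ^ (1 - s ^ 5)) * M := by
              gcongr
              exact le_three_mul_rpow hs (by linarith) (by positivity) (by linarith)
          _ = _ := by
              rw [Real.div_rpow hpos.le hl.le]
              ring)
    (acutePair_rotCoord he hσ heσ hl (a := a) (by linarith))
    ((sinAngle_rotCoord_le he hσ heσ a hl).trans (by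
      rw [div_le_iff₀ hq, mul_assoc, div_mul_eq_mul_div, mul_div_assoc', le_div_iff₀ hs]
      nlinarith))
  have hpot := conePotential_corrector_le he hσ heσ hη (by linarith) hβ.le hβη' hS a hl hlπ
  calc ν.real (arc a l) ≤ _ :=
        measureReal_mono (arc_subset_coneSet (e := e) hσ hlπ)
    _ ≤ _ := hmain
    _ ≤ (arcSupLt ν (s * l)).toReal + 2 * (12 / σ * M / l ^ (1 - s ^ 5)) *
          (2 / (1 - |e|) * l ^ (1 - s ^ 5)) := by gcongr
    _ = _ := by
      have : l ^ (1 - s ^ 5) ≠ 0 := (Real.rpow_pos_of_pos hl _).ne'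
      field_simp
      ring

/-- **Lemma 5.** For `δ₀ < |E| < 2 - δ₀`, small `λ`, and any arc `I` with `|I| ≤ λ`,
the Furstenberg measure satisfies
`ν(I) ≤ e^{C|log λ|^{1/2}} [ max_{|J|<λ^{1/10}|I|} ν(J)
  + max_{λ^{-1/10}<D<λ^{-1/5}} D⁻¹ max_{|J|<D|I|} ν(J) ]`. -/
theorem furstenberg_arc_selfimprovement
    (δ₀ : ℝ) (hδ₀ : 0 < δ₀) (hδ₀' : δ₀ < 1) (E : ℝ)
    (hE : δ₀ < |E|) (hE' : |E| < 2 - δ₀) :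
    ∃ C lam0 : ℝ, 0 < C ∧ 0 < lam0 ∧
      ∀ lam : ℝ, 0 < lam → lam < lam0 →
        ∀ ν : Measure (AddCircle (2 * Real.pi)),
          IsProbabilityMeasure ν → Stationary lam E ν →
          ∀ a l : ℝ, l ≤ lam →
            ν (arc a l) ≤
              ENNReal.ofReal (Real.exp (C * Real.sqrt |Real.log lam|)) *
                (arcSupLt ν (lam ^ ((1 : ℝ) / 10) * l) +
                  ⨆ (D : ℝ) (_ : D ∈ Set.Ioo (lam ^ (-(1 : ℝ) / 10)) (lam ^ (-(1 : ℝ) / 5))),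
                    ENNReal.ofReal D⁻¹ * arcSupLt ν (D * l)) := by
  have hE2 : |E / 2| < 1 := by
    rw [abs_div, abs_two]
    linarith
  have hE0 : E / 2 ≠ 0 := by
    have := abs_pos.1 (hδ₀.trans hE)
    simpa using this
  obtain ⟨e, rfl⟩ : ∃ e, E = 2 * e := ⟨E / 2, by ring⟩
  rw [mul_div_cancel_left₀ _ two_ne_zero] at hE2 hE0
  have hq : 0 < 1 - |e| := by linarith
  have hσ0 : 0 < 1 - e ^ 2 := by
    rw [← sq_abs]
    nlinarith [abs_nonneg e]
  set σ := Real.sqrt (1 - e ^ 2) with hσdef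
  have hσ : 0 < σ := Real.sqrt_pos.2 hσ0
  have heσ : e ^ 2 + σ ^ 2 = 1 := by
    rw [hσdef, Real.sq_sqrt hσ0.le]
    ring
  have hσ1 : σ ≤ 1 := by nlinarith [sq_nonneg e]
  obtain ⟨a₀, b₀, ha₀, hb₀⟩ := exists_corrector_coeffs hE0 hσ
  set S := ‖a₀‖ + ‖b₀‖ with hS
  have hS0 : 0 ≤ S := by positivity
  set C := 48 / (σ * (1 - |e|)) with hC
  have hC1 : 1 ≤ C := by
    rw [hC, le_div_iff₀ (by positivity)]
    nlinarith [abs_nonneg e]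
  set c₀ := min (1 / 32) (min (σ / (32 * (17 + 20 * S))) ((1 - |e|) * σ / 16)) with hc₀
  have hc₀pos : 0 < c₀ := by positivity
  refine ⟨C, c₀ ^ 10, by linarith, by positivity, fun lam hlam hlam' ν hνp hν a l hl => ?_⟩
  rcases le_or_gt l 0 with hl0 | hl0
  · simp [arc, Set.Ioo_eq_empty_of_le (show a + l ≤ a by linarith)]
  obtain ⟨s, hs, rfl⟩ : ∃ s : ℝ, 0 < s ∧ lam = s ^ 10 :=
    ⟨lam ^ ((1 : ℝ) / 10), by positivity, by
      rw [← Real.rpow_natCast, ← Real.rpow_mul hlam.le]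
      norm_num⟩
  have hsc : s < c₀ := lt_of_pow_lt_pow_left₀ 10 hc₀pos.le hlam'
  have hs1 : s < 1 / 32 := hsc.trans_le (min_le_left _ _)
  have hs2 : 32 * (17 + 20 * S) * s ≤ σ := by
    rw [← le_div_iff₀' (by positivity)]
    exact hsc.le.trans ((min_le_right _ _).trans (min_le_left _ _))
  have hs3 : 16 * s ≤ (1 - |e|) * σ := by
    rw [← le_div_iff₀' (by norm_num)]
    exact hsc.le.trans ((min_le_right _ _).trans (min_le_right _ _))
  have hpow : ∀ t : ℝ, (s ^ 10) ^ t = s ^ (10 * t) := fun t => by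
    rw [← Real.rpow_natCast, ← Real.rpow_mul hs.le]
    norm_num
  have h1 : (s ^ 10) ^ ((1 : ℝ) / 10) = s := by
    rw [hpow]
    norm_num
  have h2 : (s ^ 10) ^ (-(1 : ℝ) / 10) = s⁻¹ := by
    rw [hpow, ← Real.rpow_neg_one]
    norm_num
  have h3 : (s ^ 10) ^ (-(1 : ℝ) / 5) = (s⁻¹) ^ 2 := by
    rw [hpow, ← Real.rpow_neg_one, ← Real.rpow_natCast, ← Real.rpow_mul hs.le]
    norm_num
  rw [h1, h2, h3]
  set M := ⨆ (D : ℝ) (_ : D ∈ Set.Ioo s⁻¹ ((s⁻¹) ^ 2)),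
    ENNReal.ofReal D⁻¹ * arcSupLt ν (D * l) with hM
  have hsinv : 1 ≤ s⁻¹ := (one_le_inv₀ hs).2 (by linarith)
  have hM1 : M ≤ 1 := iSup₂_le fun D hD => mul_le_one' (by
    rw [ENNReal.ofReal_le_one]
    exact inv_le_one_of_one_le₀ (hsinv.trans hD.1.le)) (arcSupLt_le_one ν _)
  have hMtop : M ≠ ⊤ := ne_top_of_le_ne_top ENNReal.one_ne_top hM1
  have hAtop : arcSupLt ν (s * l) ≠ ⊤ :=
    ne_top_of_le_ne_top ENNReal.one_ne_top (arcSupLt_le_one ν _)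
  have hMD : ∀ D ∈ Set.Ioo s⁻¹ ((s⁻¹) ^ 2),
      (arcSupLt ν (D * l)).toReal ≤ D * M.toReal := fun D hD => by
    have hD0 : 0 < D := by linarith [hD.1]
    have h := ENNReal.toReal_mono hMtop
      (le_iSup₂ (f := fun (D : ℝ) (_ : D ∈ Set.Ioo s⁻¹ ((s⁻¹) ^ 2)) =>
        ENNReal.ofReal D⁻¹ * arcSupLt ν (D * l)) D hD)
    rw [ENNReal.toReal_mul, ENNReal.toReal_ofReal (inv_nonneg.2 hD0.le)] at h
    exact (inv_mul_le_iff₀ hD0).1 h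
  have hreal := real_arc_le hE2 hσ heσ ha₀ hb₀ hS.symm hs hs1.le hs2 hs3 rfl hl0 hl hν
    ENNReal.toReal_nonneg hMD a
  have hexp : C ≤ Real.exp (C * Real.sqrt |Real.log (s ^ 10)|) := by
    have hlog : Real.log (s ^ 10) ≤ -1 := by
      have h := Real.log_le_sub_one_of_pos hs
      rw [Real.log_pow]
      push_cast
      linarith
    have hsqrt : 1 ≤ Real.sqrt |Real.log (s ^ 10)| := by
      rw [Real.one_le_sqrt, abs_of_neg (by linarith)]
      linarith
    have := Real.add_one_le_exp (C * Real.sqrt |Real.log (s ^ 10)|)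
    nlinarith
  have hA0 : 0 ≤ (arcSupLt ν (s * l)).toReal := ENNReal.toReal_nonneg
  have hM0 : 0 ≤ M.toReal := ENNReal.toReal_nonneg
  rw [← ENNReal.ofReal_toReal (measure_ne_top ν (arc a l)), ← ENNReal.ofReal_toReal hAtop,
    ← ENNReal.ofReal_toReal hMtop, ← ENNReal.ofReal_add hA0 hM0,
    ← ENNReal.ofReal_mul (Real.exp_nonneg _)]
  refine ENNReal.ofReal_le_ofReal (hreal.trans ?_)
  calc _ ≤ C * ((arcSupLt ν (s * l)).toReal + M.toReal) := by nlinarith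
    _ ≤ _ := by gcongr
end
end

section
/- Fix δ₀ ∈ (0,1) and δ₀ < |E| < 2 − δ₀, and let ν = ν_E^{(λ)} be the Furstenberg measure. For λ > 0 sufficiently small there exists a discrete (countably supported) probability measure μ̃ on SL₂(ℝ) such that every g in the support of μ̃ satisfies λ^{−1/10} < ‖g‖ < 2 λ^{−1/10}, and ν = ∫ (τ_g)_*[ν] dμ̃(g). -/
open MeasureTheory

noncomputable section

/-- Operator norm of a `2 × 2` real matrix acting on Euclidean `ℝ²`. -/
def opNorm (g : Matrix (Fin 2) (Fin 2) ℝ) : ℝ :=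
  ‖Matrix.toEuclideanCLM (𝕜 := ℝ) g‖

section StoppedWalk

open Filter Topology

variable {Γ : Type*} [Group Γ]

/-- The distribution, after one step of the right random walk with increments `a` and `b`
(each of probability `1/2`), of a walk with current distribution `α`. -/
def walkStep (a b : Γ) (α : Γ → ENNReal) (g : Γ) : ENNReal :=
  (α (g * a⁻¹) + α (g * b⁻¹)) / 2

open Classical in
/-- The distribution at time `n` of the walk started at `1` and killed when it leaves `A`. -/
def killedWalk (a b : Γ) (A : Set Γ) : ℕ → Γ → ENNReal
  | 0 => Pi.single 1 1
  | n + 1 => A.indicator (walkStep a b (killedWalk a b A n))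

/-- The probability that the walk leaves `A` at time `n + 1`, at the point `g`. -/
def exitWalk (a b : Γ) (A : Set Γ) (n : ℕ) : Γ → ENNReal :=
  Aᶜ.indicator (walkStep a b (killedWalk a b A n))

/-- The probability that the walk started at `g` stays in `A` during the next `m` steps. -/
def survival (a b : Γ) (A : Set Γ) : ℕ → Γ → ENNReal
  | 0 => 1
  | m + 1 => fun g =>
      (A.indicator (survival a b A m) (g * a) + A.indicator (survival a b A m) (g * b)) / 2

variable {a b : Γ} {A : Set Γ}

lemma tsum_walkStep_mul (α h : Γ → ENNReal) :
    ∑' g, walkStep a b α g * h g = ∑' g, α g * ((h (g * a) + h (g * b)) / 2) := by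
  have key : ∀ c : Γ, ∑' g, α (g * c⁻¹) * (h g / 2) = ∑' g, α g * (h (g * c) / 2) := by
    intro c
    rw [← (Equiv.mulRight c).tsum_eq]
    simp
  have e₁ : ∀ g, walkStep a b α g * h g =
      α (g * a⁻¹) * (h g / 2) + α (g * b⁻¹) * (h g / 2) := by
    intro g
    simp only [walkStep, div_eq_mul_inv]
    ring
  have e₂ : ∀ g, α g * ((h (g * a) + h (g * b)) / 2) =
      α g * (h (g * a) / 2) + α g * (h (g * b) / 2) := by
    intro g
    simp only [div_eq_mul_inv]
    ring
  simp only [e₁, e₂, ENNReal.tsum_add, key]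

lemma indicator_mul_comm_ennreal {X : Type*} (s : Set X) (α h : X → ENNReal) (g : X) :
    s.indicator α g * h g = α g * s.indicator h g := by
  by_cases hg : g ∈ s <;> simp [hg]

lemma tsum_killedWalk_add (n m : ℕ) :
    ∑' g, killedWalk a b A (n + m) g = ∑' g, killedWalk a b A n g * survival a b A m g := by
  induction m generalizing n with
  | zero => simp [survival]
  | succ m ih =>
    rw [show n + (m + 1) = (n + 1) + m by ring, ih]
    simp only [killedWalk, indicator_mul_comm_ennreal, survival]
    rw [tsum_walkStep_mul]

lemma survival_le_one (m : ℕ) (g : Γ) : survival a b A m g ≤ 1 := by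
  induction m generalizing g with
  | zero => simp [survival]
  | succ m ih =>
    have hi : ∀ g, A.indicator (survival a b A m) g ≤ 1 :=
      fun g => (Set.indicator_le_self' (fun _ _ => zero_le) g).trans (ih g)
    calc survival a b A (m + 1) g ≤ (1 + 1) / 2 := by
          simp only [survival]
          gcongr <;> apply hi
      _ = 1 := by rw [one_add_one_eq_two, ENNReal.div_self] <;> simp

/-- If a word in `a`, `b` drives the walk from `g ∈ A` out of `A`, then the walk exits with
at least the probability of that word. -/
lemma survival_add_le_one (l : List Γ) (hl : ∀ x ∈ l, x = a ∨ x = b) (g : Γ) (hg : g ∈ A)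
    (hout : g * l.prod ∉ A) : survival a b A l.length g + 2⁻¹ ^ l.length ≤ 1 := by
  induction l generalizing g with
  | nil => simp [hg] at hout
  | cons x l ih =>
    have hle : ∀ g, A.indicator (survival a b A l.length) g ≤ 1 :=
      fun g => (Set.indicator_le_self' (fun _ _ => zero_le) g).trans (survival_le_one _ g)
    have hx : A.indicator (survival a b A l.length) (g * x) + 2⁻¹ ^ l.length ≤ 1 := by
      by_cases hgx : g * x ∈ A
      · rw [Set.indicator_of_mem hgx]
        refine ih (fun y hy => hl y (List.mem_cons_of_mem _ hy)) _ hgx ?_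
        simpa [mul_assoc] using hout
      · rw [Set.indicator_of_notMem hgx, zero_add]
        exact pow_le_one₀ zero_le (by simp)
    have hsum : A.indicator (survival a b A l.length) (g * a) +
        A.indicator (survival a b A l.length) (g * b) + 2⁻¹ ^ l.length ≤ 2 := by
      refine le_of_le_of_eq ?_ one_add_one_eq_two
      rcases hl x List.mem_cons_self with rfl | rfl
      · rw [add_right_comm]
        exact add_le_add hx (hle _)
      · rw [add_assoc]
        exact add_le_add (hle _) hx
    calc survival a b A (x :: l).length g + 2⁻¹ ^ (x :: l).length
        = (A.indicator (survival a b A l.length) (g * a) +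
            A.indicator (survival a b A l.length) (g * b) + 2⁻¹ ^ l.length) / 2 := by
          simp only [List.length_cons, survival, pow_succ, div_eq_mul_inv]
          ring
      _ ≤ 2 / 2 := by gcongr
      _ = 1 := ENNReal.div_self (by simp) (by simp)

lemma mem_of_killedWalk_ne_zero (h1 : (1 : Γ) ∈ A) {n : ℕ} {g : Γ}
    (hg : killedWalk a b A n g ≠ 0) : g ∈ A := by
  cases n with
  | zero =>
    by_cases h : g = 1
    · exact h ▸ h1
    · simp [killedWalk, h] at hg
  | succ n =>
    by_contra h
    simp [killedWalk, h] at hg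

lemma tsum_killedWalk_zero : ∑' g, killedWalk a b A 0 g = 1 := by
  classical
  simp only [killedWalk]
  exact tsum_pi_single 1 1

/-- The mass of the killed walk decays geometrically when a fixed word leaves `A`. -/
lemma tsum_killedWalk_mul_le (h1 : (1 : Γ) ∈ A) (l : List Γ) (hl : ∀ x ∈ l, x = a ∨ x = b)
    (hout : ∀ g ∈ A, g * l.prod ∉ A) (j : ℕ) :
    ∑' g, killedWalk a b A (l.length * j) g ≤ (1 - 2⁻¹ ^ l.length) ^ j := by
  induction j with
  | zero => simp [tsum_killedWalk_zero]
  | succ j ih =>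
    rw [mul_add, mul_one, tsum_killedWalk_add, pow_succ]
    calc ∑' g, killedWalk a b A (l.length * j) g * survival a b A l.length g
        ≤ ∑' g, killedWalk a b A (l.length * j) g * (1 - 2⁻¹ ^ l.length) := by
          refine ENNReal.tsum_le_tsum fun g => ?_
          by_cases hg : killedWalk a b A (l.length * j) g = 0
          · simp [hg]
          · have hgA := mem_of_killedWalk_ne_zero h1 hg
            gcongr
            exact ENNReal.le_sub_of_add_le_right (by simp)
              (survival_add_le_one l hl g hgA (hout g hgA))
      _ ≤ _ := by
          rw [ENNReal.tsum_mul_right]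
          gcongr

lemma sum_exitWalk_add_killedWalk {h : Γ → ENNReal}
    (hh : ∀ g, h g = (h (g * a) + h (g * b)) / 2) (n : ℕ) :
    h 1 = ∑ k ∈ Finset.range n, ∑' g, exitWalk a b A k g * h g +
      ∑' g, killedWalk a b A n g * h g := by
  induction n with
  | zero =>
    classical
    simp only [Finset.range_zero, Finset.sum_empty, zero_add, killedWalk]
    rw [tsum_eq_single 1 (fun g hg => by simp [hg])]
    simp
  | succ n ih =>
    rw [ih, Finset.sum_range_succ, add_assoc]
    congr 1
    rw [← ENNReal.tsum_add]
    calc ∑' g, killedWalk a b A n g * h g = ∑' g, walkStep a b (killedWalk a b A n) g * h g := by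
          rw [tsum_walkStep_mul]
          simp only [← hh]
      _ = _ := by
          refine tsum_congr fun g => ?_
          by_cases hg : g ∈ A <;> simp [exitWalk, killedWalk, hg]

/-- Optional stopping for a bounded harmonic function at the exit time from `A`. -/
theorem tsum_exitWalk_mul_of_harmonic (h1 : (1 : Γ) ∈ A) (l : List Γ)
    (hl : ∀ x ∈ l, x = a ∨ x = b) (hout : ∀ g ∈ A, g * l.prod ∉ A) {h : Γ → ENNReal}
    (hle : ∀ g, h g ≤ 1) (hh : ∀ g, h g = (h (g * a) + h (g * b)) / 2) :
    ∑' g, (∑' k, exitWalk a b A k g) * h g = h 1 := by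
  have hlen : 0 < l.length := by
    rcases l with _ | ⟨x, l⟩
    · exact absurd h1 (by simpa using hout 1 h1)
    · simp
  have hsub : Tendsto (fun j : ℕ => l.length * j) atTop atTop :=
    tendsto_id.const_mul_atTop' hlen
  have hlt : (1 - 2⁻¹ ^ l.length : ENNReal) < 1 :=
    ENNReal.sub_lt_self (by simp) (by simp) (by simp)
  have hrem : Tendsto (fun j : ℕ => ∑' g, killedWalk a b A (l.length * j) g * h g) atTop (𝓝 0) := by
    refine tendsto_of_tendsto_of_tendsto_of_le_of_le tendsto_const_nhds
      (ENNReal.tendsto_pow_atTop_nhds_zero_of_lt_one hlt) (fun _ => zero_le) fun j => ?_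
    refine le_trans ?_ (tsum_killedWalk_mul_le h1 l hl hout j)
    exact ENNReal.tsum_le_tsum fun g => mul_le_of_le_one_right zero_le (hle g)
  have hlim := ((ENNReal.tendsto_nat_tsum
    fun k => ∑' g, exitWalk a b A k g * h g).comp hsub).add hrem
  simp only [Function.comp_def, ← sum_exitWalk_add_killedWalk hh, add_zero] at hlim
  simp only [← ENNReal.tsum_mul_right]
  rw [ENNReal.tsum_comm]
  exact tendsto_nhds_unique hlim tendsto_const_nhds |>.symm ▸ rfl

open scoped Pointwise in
lemma exists_of_walkStep_killedWalk_ne_zero (n j : ℕ) {g : Γ}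
    (hg : walkStep a b (killedWalk a b A (n + j)) g ≠ 0) :
    ∃ g', killedWalk a b A n g' ≠ 0 ∧ ∃ u ∈ ({a, b} : Set Γ) ^ (j + 1), g = g' * u := by
  induction j generalizing g with
  | zero =>
    simp only [walkStep, ne_eq, ENNReal.div_eq_zero_iff, add_eq_zero, not_or, not_and_or] at hg
    rcases hg.1 with h | h
    · exact ⟨_, h, a, by simp, by simp⟩
    · exact ⟨_, h, b, by simp, by simp⟩
  | succ j ih =>
    have hstep : ∀ {g}, killedWalk a b A (n + (j + 1)) g ≠ 0 →
        walkStep a b (killedWalk a b A (n + j)) g ≠ 0 := by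
      intro g hg h0
      rw [← add_assoc, killedWalk] at hg
      by_cases hgA : g ∈ A <;> simp [hgA, h0] at hg
    simp only [walkStep, ne_eq, ENNReal.div_eq_zero_iff, add_eq_zero, not_or, not_and_or] at hg
    rcases hg.1 with h | h
    · obtain ⟨g', hg', u, hu, e⟩ := ih (hstep h)
      exact ⟨g', hg', u * a, by rw [pow_succ]; exact Set.mul_mem_mul hu (by simp),
        by rw [← mul_assoc, ← e]; simp⟩
    · obtain ⟨g', hg', u, hu, e⟩ := ih (hstep h)
      exact ⟨g', hg', u * b, by rw [pow_succ]; exact Set.mul_mem_mul hu (by simp),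
        by rw [← mul_assoc, ← e]; simp⟩

end StoppedWalk

section OperatorNorm

lemma opNorm_mul_le (g h : Matrix (Fin 2) (Fin 2) ℝ) : opNorm (g * h) ≤ opNorm g * opNorm h := by
  rw [opNorm, map_mul]
  exact norm_mul_le _ _

lemma opNorm_nonneg (g : Matrix (Fin 2) (Fin 2) ℝ) : 0 ≤ opNorm g := norm_nonneg _

lemma opNorm_one : opNorm 1 = 1 := by
  rw [opNorm, map_one, norm_one]

lemma continuous_opNorm : Continuous opNorm :=
  (LinearMap.continuous_of_finiteDimensional
    (Matrix.toEuclideanCLM (n := Fin 2) (𝕜 := ℝ)).toAlgEquiv.toLinearMap).norm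

lemma abs_apply_le_opNorm (g : Matrix (Fin 2) (Fin 2) ℝ) (i j : Fin 2) : |g i j| ≤ opNorm g := by
  have h := (Matrix.toEuclideanCLM (𝕜 := ℝ) g).le_opNorm (EuclideanSpace.single j 1)
  rw [PiLp.norm_single, norm_one, mul_one] at h
  refine le_trans ?_ h
  have h' := PiLp.norm_apply_le
    (Matrix.toEuclideanCLM (𝕜 := ℝ) g (EuclideanSpace.single j 1)) i
  simpa [Matrix.ofLp_toEuclideanCLM] using h'

/-- In dimension two, the adjugate has comparable operator norm. -/
lemma exists_opNorm_adjugate_le :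
    ∃ K : ℝ, 0 < K ∧ ∀ g : Matrix (Fin 2) (Fin 2) ℝ, opNorm g.adjugate ≤ K * opNorm g := by
  let J : Matrix (Fin 2) (Fin 2) ℝ := !![0, 1; -1, 0]
  have hT : ∀ g : Matrix (Fin 2) (Fin 2) ℝ, opNorm (star g) = opNorm g := fun g => by
    rw [opNorm, map_star, ContinuousLinearMap.star_eq_adjoint, LinearIsometryEquiv.norm_map, opNorm]
  have hadj : ∀ g : Matrix (Fin 2) (Fin 2) ℝ, g.adjugate = -J * star g * J := by
    intro g
    ext i j
    fin_cases i <;> fin_cases j <;>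
      simp [J, Matrix.adjugate_fin_two, Matrix.mul_apply, Fin.sum_univ_two,
        Matrix.star_eq_conjTranspose, Matrix.vecMul, dotProduct]
  refine ⟨opNorm (-J) * opNorm J + 1, by
    have := mul_nonneg (opNorm_nonneg (-J)) (opNorm_nonneg J); linarith, fun g => ?_⟩
  rw [hadj]
  have h₁ := opNorm_mul_le (-J * star g) J
  have h₂ := mul_le_mul_of_nonneg_right (opNorm_mul_le (-J) (star g)) (opNorm_nonneg J)
  rw [hT] at h₂
  nlinarith [opNorm_nonneg g]

end OperatorNorm

section Recurrence

open Filter Topology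

/-- The powers of an elliptic transfer matrix return arbitrarily close to the identity. -/
lemma exists_pow_mem_nhds_one {t : ℝ} (ht : |t| < 2) {U : Set (Matrix (Fin 2) (Fin 2) ℝ)}
    (hU : U ∈ 𝓝 1) : ∃ k : ℕ, 0 < k ∧ (!![t, -1; 1, 0] : Matrix (Fin 2) (Fin 2) ℝ) ^ k ∈ U := by
  obtain ⟨ht₁, ht₂⟩ := abs_lt.1 ht
  set θ := Real.arccos (t / 2) with hθ
  have hcos : t = 2 * Real.cos θ := by
    rw [hθ, Real.cos_arccos (by linarith) (by linarith)]
    ring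
  have hsin : Real.sin θ ≠ 0 := by
    refine (Real.sin_pos_of_pos_of_lt_pi (Real.arccos_pos.2 (by linarith)) ?_).ne'
    exact lt_of_le_of_ne (Real.arccos_le_pi _) fun h => by
      rw [Real.arccos_eq_pi] at h
      linarith
  let F : ℝ → Matrix (Fin 2) (Fin 2) ℝ := fun x =>
    !![Real.sin (x + θ) / Real.sin θ, -(Real.sin x / Real.sin θ);
      Real.sin x / Real.sin θ, -(Real.sin (x - θ) / Real.sin θ)]
  have hF0 : F 0 = 1 := by
    simp [F, hsin, Matrix.one_fin_two]
  have hpow : ∀ k : ℕ, (!![t, -1; 1, 0] : Matrix (Fin 2) (Fin 2) ℝ) ^ k = F (k * θ) := by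
    intro k
    induction k with
    | zero => simp [hF0]
    | succ k ih =>
      rw [pow_succ, ih, hcos]
      simp only [F, Matrix.mul_fin_two]
      push_cast
      have e₁ : ∀ x : ℝ, Real.sin (x + θ + θ) = Real.sin (x + θ) * (2 * Real.cos θ) - Real.sin x := by
        intro x
        have h₁ := Real.sin_add (x + θ) θ
        have h₂ := Real.sin_sub (x + θ) θ
        rw [add_sub_cancel_right] at h₂
        linarith
      have e₂ : ∀ x : ℝ, Real.sin (x + θ) = Real.sin x * (2 * Real.cos θ) - Real.sin (x - θ) := by
        intro x
        rw [Real.sin_add, Real.sin_sub]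
        ring
      have e₃ : ((k : ℝ) + 1) * θ = k * θ + θ := by ring
      ext i j
      fin_cases i <;> fin_cases j <;> simp [e₃]
      · rw [e₁]; ring
      · rw [e₂]; ring
  have hcont : Continuous F := by
    refine continuous_matrix fun i j => ?_
    fin_cases i <;> fin_cases j <;> simp only [F] <;> simp <;> fun_prop
  have hper : ∀ (x : ℝ) (m : ℤ), F (x - m * (2 * Real.pi)) = F x := by
    intro x m
    simp only [F]
    rw [sub_add_eq_add_sub, sub_right_comm]
    simp only [Real.sin_sub_int_mul_two_pi]
  have hnear : ∀ᶠ x in 𝓝 (0 : ℝ), F x ∈ U :=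
    hcont.continuousAt.eventually_mem (hF0.symm ▸ hU)
  obtain ⟨ε, hε, hball⟩ := Metric.eventually_nhds_iff.1 hnear
  obtain ⟨n, hn⟩ := exists_nat_gt (2 * Real.pi / ε)
  have hpi := Real.pi_pos
  have hn0 : 0 < n := by
    have : (0 : ℝ) < n := lt_trans (by positivity) hn
    exact_mod_cast this
  obtain ⟨k, hk, -, hround⟩ := Real.exists_nat_abs_mul_sub_round_le (θ / (2 * Real.pi)) hn0
  refine ⟨k, hk, ?_⟩
  rw [hpow, ← hper _ (round ((k : ℝ) * (θ / (2 * Real.pi))))]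
  refine hball ?_
  have e : (k : ℝ) * θ - (round ((k : ℝ) * (θ / (2 * Real.pi))) : ℤ) * (2 * Real.pi) =
      (k * (θ / (2 * Real.pi)) - (round ((k : ℝ) * (θ / (2 * Real.pi))) : ℤ)) * (2 * Real.pi) := by
    field_simp
  rw [dist_zero_right, Real.norm_eq_abs, e, abs_mul, abs_of_pos (by positivity : 0 < 2 * Real.pi)]
  rw [div_lt_iff₀ hε] at hn
  calc _ ≤ 1 / ((n : ℝ) + 1) * (2 * Real.pi) := by gcongr
    _ < ε := by
      rw [div_mul_eq_mul_div, one_mul, div_lt_iff₀ (by positivity)]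
      nlinarith

end Recurrence

section ProjectiveAction

open Real

lemma tauC_periodic (g : Matrix (Fin 2) (Fin 2) ℝ) : Function.Periodic (tauC g) (2 * π) := by
  intro θ
  simp [tauC]

lemma tauMap_coe (g : Matrix (Fin 2) (Fin 2) ℝ) (θ : ℝ) :
    tauMap g (θ : AddCircle (2 * π)) = tauC g θ := by
  have hp : (0 : ℝ) < 2 * π := Fact.out
  change tauC g (toIcoMod hp 0 θ) = tauC g θ
  exact (tauC_periodic g).sub_zsmul_eq _

lemma measurable_tauMap (g : Matrix (Fin 2) (Fin 2) ℝ) : Measurable (tauMap g) := by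
  have hC : Measurable (tauC g) := by
    unfold tauC
    refine AddCircle.measurable_mk'.comp (Complex.measurable_arg.comp ?_)
    fun_prop
  exact hC.comp
    (measurable_subtype_coe.comp (AddCircle.measurableEquivIco (2 * π) 0).measurable)

lemma tauMap_one : tauMap 1 = id := by
  funext x
  obtain ⟨θ, rfl⟩ := QuotientAddGroup.mk_surjective x
  refine (tauMap_coe 1 θ).trans ?_
  have h := Complex.arg_cos_add_sin_mul_I_coe_angle (θ : Real.Angle)
  simp only [Real.Angle.cos_coe, Real.Angle.sin_coe] at h
  simp only [tauC, Matrix.one_apply_eq, Matrix.one_apply_ne (show (0 : Fin 2) ≠ 1 by decide),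
    Matrix.one_apply_ne (show (1 : Fin 2) ≠ 0 by decide)]
  rw [mul_comm Complex.I]
  simp only [one_mul, zero_mul, add_zero, zero_add]
  exact h

lemma tauMap_mul {g h : Matrix (Fin 2) (Fin 2) ℝ} (hh : h.det ≠ 0) (x : AddCircle (2 * π)) :
    tauMap (g * h) x = tauMap g (tauMap h x) := by
  obtain ⟨θ, rfl⟩ := QuotientAddGroup.mk_surjective x
  refine (tauMap_coe _ θ).trans ?_
  refine Eq.trans ?_ (congrArg (tauMap g) (tauMap_coe h θ)).symm
  set z : ℂ := (h 0 0 * cos θ + h 0 1 * sin θ : ℝ) +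
    Complex.I * (h 1 0 * cos θ + h 1 1 * sin θ : ℝ) with hz
  have hre : z.re = h 0 0 * cos θ + h 0 1 * sin θ := by simp [hz, -Complex.ofReal_add, -Complex.ofReal_mul]
  have him : z.im = h 1 0 * cos θ + h 1 1 * sin θ := by simp [hz, -Complex.ofReal_add, -Complex.ofReal_mul]
  have hz0 : z ≠ 0 := by
    intro h0
    rw [h0, Complex.zero_re] at hre
    rw [h0, Complex.zero_im] at him
    rw [Matrix.det_fin_two] at hh
    have h₁ : (h 0 0 * h 1 1 - h 0 1 * h 1 0) * cos θ = 0 := by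
      linear_combination h 0 1 * him - h 1 1 * hre
    have h₂ : (h 0 0 * h 1 1 - h 0 1 * h 1 0) * sin θ = 0 := by
      linear_combination h 1 0 * hre - h 0 0 * him
    have := sin_sq_add_cos_sq θ
    rw [(mul_eq_zero.1 h₁).resolve_left hh, (mul_eq_zero.1 h₂).resolve_left hh] at this
    norm_num at this
  have hC : tauC h θ = (z.arg : AddCircle (2 * π)) := rfl
  rw [hC, tauMap_coe]
  unfold tauC
  congr 1
  have hnorm : 0 < ‖z‖⁻¹ := inv_pos.2 (norm_pos_iff.2 hz0)
  rw [Complex.cos_arg hz0, Complex.sin_arg, ← Complex.arg_real_mul _ hnorm, hre, him]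
  congr 1
  apply Complex.ext
  · simp [-Complex.ofReal_add, -Complex.ofReal_mul, Matrix.mul_apply, Fin.sum_univ_two]
    ring
  · simp [-Complex.ofReal_add, -Complex.ofReal_mul, Matrix.mul_apply, Fin.sum_univ_two]
    ring

end ProjectiveAction

section TransferMatrices

open Filter Topology Matrix
open scoped Pointwise

/-- The single-step Anderson–Bernoulli matrix as an element of `SL₂(ℝ)`. -/
def transferSL (lam E x : ℝ) : SpecialLinearGroup (Fin 2) ℝ :=
  ⟨gE lam E x, by simp [gE, Matrix.det_fin_two_of]⟩

lemma coe_transferSL (lam E x : ℝ) :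
    (transferSL lam E x : Matrix (Fin 2) (Fin 2) ℝ) = !![E - lam * x, -1; 1, 0] := rfl

lemma opNorm_add_le (g h : Matrix (Fin 2) (Fin 2) ℝ) : opNorm (g + h) ≤ opNorm g + opNorm h := by
  rw [opNorm, map_add]
  exact norm_add_le _ _

lemma opNorm_smul (c : ℝ) (g : Matrix (Fin 2) (Fin 2) ℝ) : opNorm (c • g) = |c| * opNorm g := by
  rw [opNorm, map_smul, norm_smul, Real.norm_eq_abs, opNorm]

lemma opNorm_pow_le {S : Set (SpecialLinearGroup (Fin 2) ℝ)} {B : ℝ}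
    (hS : ∀ u ∈ S, opNorm u ≤ B) (k : ℕ) :
    ∀ u ∈ S ^ k, opNorm (u : Matrix (Fin 2) (Fin 2) ℝ) ≤ B ^ k := by
  induction k with
  | zero =>
    intro u hu
    rw [pow_zero, Set.mem_one] at hu
    simp [hu, opNorm_one]
  | succ k ih =>
    intro u hu
    rw [pow_succ] at hu
    obtain ⟨v, hv, x, hx, rfl⟩ := Set.mem_mul.1 hu
    change opNorm ((v : Matrix (Fin 2) (Fin 2) ℝ) * x) ≤ B ^ (k + 1)
    rw [pow_succ]
    exact (opNorm_mul_le _ _).trans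
      (mul_le_mul (ih v hv) (hS x hx) (opNorm_nonneg _) ((opNorm_nonneg _).trans (ih v hv)))

/-- Words of length `k` in matrices close to `A` are close to `A ^ k`. -/
lemma opNorm_sub_pow_le {S : Set (SpecialLinearGroup (Fin 2) ℝ)} {A : Matrix (Fin 2) (Fin 2) ℝ}
    {r : ℝ} (hS : ∀ u ∈ S, opNorm ((u : Matrix (Fin 2) (Fin 2) ℝ) - A) ≤ r) (k : ℕ) :
    ∀ u ∈ S ^ k, opNorm ((u : Matrix (Fin 2) (Fin 2) ℝ) - A ^ k) ≤
      (opNorm A + r) ^ k - opNorm A ^ k := by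
  have hA : ∀ k : ℕ, opNorm (A ^ k) ≤ opNorm A ^ k := by
    intro k
    induction k with
    | zero => simp [opNorm_one]
    | succ k ih =>
      rw [pow_succ, pow_succ]
      exact (opNorm_mul_le _ _).trans (mul_le_mul_of_nonneg_right ih (opNorm_nonneg _))
  induction k with
  | zero =>
    intro u hu
    rw [pow_zero, Set.mem_one] at hu
    simp [hu, opNorm]
  | succ k ih =>
    intro u hu
    rw [pow_succ] at hu
    obtain ⟨v, hv, x, hx, rfl⟩ := Set.mem_mul.1 hu
    have hxn : opNorm (x : Matrix (Fin 2) (Fin 2) ℝ) ≤ opNorm A + r := by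
      have := opNorm_add_le A (x - A)
      rw [add_sub_cancel] at this
      linarith [hS x hx]
    have e : ((v * x : SpecialLinearGroup (Fin 2) ℝ) : Matrix (Fin 2) (Fin 2) ℝ) - A ^ (k + 1) =
        ((v : Matrix (Fin 2) (Fin 2) ℝ) - A ^ k) * x + A ^ k * (x - A) := by
      change (v : Matrix (Fin 2) (Fin 2) ℝ) * x - A ^ (k + 1) = _
      rw [pow_succ]
      noncomm_ring
    rw [e]
    have h₁ := (opNorm_mul_le ((v : Matrix (Fin 2) (Fin 2) ℝ) - A ^ k) x).trans
      (mul_le_mul (ih v hv) hxn (opNorm_nonneg _) ((opNorm_nonneg _).trans (ih v hv)))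
    have h₂ := (opNorm_mul_le (A ^ k) ((x : Matrix (Fin 2) (Fin 2) ℝ) - A)).trans
      (mul_le_mul (hA k) (hS x hx) (opNorm_nonneg _) (pow_nonneg (opNorm_nonneg _) _))
    refine (opNorm_add_le _ _).trans ((add_le_add h₁ h₂).trans (le_of_eq ?_))
    ring

/-- For small `lam`, some block length makes every word of that length have norm below `2`,
while shorter words are uniformly bounded. -/
lemma exists_block_opNorm_lt_two {E : ℝ} (hE : |E| < 2) :
    ∃ (k : ℕ) (C : ℝ), 0 < k ∧ ∀ᶠ lam in 𝓝[>] (0 : ℝ),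
      (∀ u ∈ ({transferSL lam E 1, transferSL lam E (-1)} : Set (SpecialLinearGroup (Fin 2) ℝ)) ^ k,
        opNorm u < 2) ∧
      ∀ j ≤ k, ∀ u ∈
        ({transferSL lam E 1, transferSL lam E (-1)} : Set (SpecialLinearGroup (Fin 2) ℝ)) ^ j,
          opNorm u ≤ C := by
  set A : Matrix (Fin 2) (Fin 2) ℝ := !![E, -1; 1, 0] with hA
  set D : Matrix (Fin 2) (Fin 2) ℝ := !![1, 0; 0, 0] with hD
  have hopen : IsOpen {X : Matrix (Fin 2) (Fin 2) ℝ | opNorm X < 3 / 2} :=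
    isOpen_lt continuous_opNorm continuous_const
  obtain ⟨k, hk, hkA⟩ := exists_pow_mem_nhds_one hE
    (hopen.mem_nhds (by rw [Set.mem_ofPred_eq, opNorm_one]; norm_num))
  rw [Set.mem_ofPred_eq] at hkA
  have hA0 := opNorm_nonneg A
  have hD0 := opNorm_nonneg D
  refine ⟨k, (opNorm A + opNorm D + 1) ^ k, hk, ?_⟩
  have hlim : ∀ᶠ lam in 𝓝 (0 : ℝ),
      (opNorm A + lam * opNorm D) ^ k - opNorm A ^ k < 1 / 2 := by
    have hc : Continuous fun lam : ℝ => (opNorm A + lam * opNorm D) ^ k - opNorm A ^ k := by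
      fun_prop
    refine hc.continuousAt.eventually_lt continuousAt_const ?_
    simp
  filter_upwards [nhdsWithin_le_nhds hlim, nhdsWithin_le_nhds (eventually_le_nhds zero_lt_one),
    self_mem_nhdsWithin] with lam h₁ h₂ h₃
  replace h₃ : 0 < lam := h₃
  have hS : ∀ u ∈ ({transferSL lam E 1, transferSL lam E (-1)} :
      Set (SpecialLinearGroup (Fin 2) ℝ)),
      opNorm ((u : Matrix (Fin 2) (Fin 2) ℝ) - A) ≤ lam * opNorm D := by
    have hx : ∀ x : ℝ, |x| = 1 → opNorm ((transferSL lam E x : Matrix (Fin 2) (Fin 2) ℝ) - A) ≤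
        lam * opNorm D := by
      intro x hx
      have e : (transferSL lam E x : Matrix (Fin 2) (Fin 2) ℝ) - A = (-(lam * x)) • D := by
        rw [coe_transferSL, hA, hD]
        ext i j
        fin_cases i <;> fin_cases j <;> simp
      rw [e, opNorm_smul, abs_neg, abs_mul, hx, mul_one, abs_of_pos h₃]
    rintro u (rfl | rfl)
    · exact hx 1 (by simp)
    · exact hx (-1) (by simp)
  refine ⟨fun u hu => ?_, fun j hj u hu => ?_⟩
  · have h := opNorm_sub_pow_le hS k u hu
    have h' := opNorm_add_le ((u : Matrix (Fin 2) (Fin 2) ℝ) - A ^ k) (A ^ k)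
    rw [sub_add_cancel] at h'
    linarith
  · have hS' : ∀ u ∈ ({transferSL lam E 1, transferSL lam E (-1)} :
        Set (SpecialLinearGroup (Fin 2) ℝ)),
        opNorm (u : Matrix (Fin 2) (Fin 2) ℝ) ≤ opNorm A + opNorm D + 1 := by
      intro u hu
      have h' := opNorm_add_le ((u : Matrix (Fin 2) (Fin 2) ℝ) - A) A
      rw [sub_add_cancel] at h'
      nlinarith [hS u hu]
    exact (opNorm_pow_le hS' j u hu).trans (pow_le_pow_right₀ (by linarith) hj)

/-- The semigroup generated by the two transfer matrices is unbounded. -/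
lemma exists_word_lt_opNorm {lam E : ℝ} (hlam : 0 < lam) (hE : |E + lam| < 2) (R : ℝ) :
    ∃ l : List (SpecialLinearGroup (Fin 2) ℝ),
      (∀ x ∈ l, x = transferSL lam E 1 ∨ x = transferSL lam E (-1)) ∧ R < opNorm l.prod := by
  set a := transferSL lam E 1
  set b := transferSL lam E (-1)
  have hb : (b : Matrix (Fin 2) (Fin 2) ℝ) = !![E + lam, -1; 1, 0] := by
    rw [coe_transferSL]
    simp
  let M : Matrix (Fin 2) (Fin 2) ℝ := !![1, -(2 * lam); 0, 1]
  have hM : ∀ m : ℕ, M ^ m = !![1, -(2 * lam * m); 0, 1] := by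
    intro m
    induction m with
    | zero => simp [Matrix.one_fin_two]
    | succ m ih =>
      rw [pow_succ, ih]
      simp only [M, Matrix.mul_fin_two]
      ext i j
      fin_cases i <;> fin_cases j <;> simp
      ring
  have hab : (a : Matrix (Fin 2) (Fin 2) ℝ) = M * b := by
    rw [hb, coe_transferSL]
    simp only [M, Matrix.mul_fin_two]
    ext i j
    fin_cases i <;> fin_cases j <;> simp
    ring
  obtain ⟨m, hm⟩ := exists_nat_gt (R / (2 * lam))
  rw [div_lt_iff₀ (by positivity)] at hm
  have hopen : IsOpen {X : Matrix (Fin 2) (Fin 2) ℝ | R < opNorm ((M * X) ^ m)} :=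
    isOpen_lt continuous_const (continuous_opNorm.comp (by fun_prop))
  have hmem : (1 : Matrix (Fin 2) (Fin 2) ℝ) ∈ {X | R < opNorm ((M * X) ^ m)} := by
    rw [Set.mem_ofPred_eq, mul_one, hM]
    have h := abs_apply_le_opNorm !![1, -(2 * lam * m); 0, 1] 0 1
    have h' := neg_le_abs (-(2 * lam * (m : ℝ)))
    simp only [Matrix.of_apply, Matrix.cons_val', Matrix.cons_val_zero, Matrix.cons_val_one,
      Matrix.cons_val_fin_one] at h
    linarith
  obtain ⟨k, hk, hkU⟩ := exists_pow_mem_nhds_one hE (hopen.mem_nhds hmem)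
  refine ⟨(List.replicate m (a :: List.replicate (k - 1) b)).flatten, fun x hx => ?_, ?_⟩
  · simp only [List.mem_flatten, List.mem_replicate] at hx
    obtain ⟨l, ⟨-, rfl⟩, hx⟩ := hx
    rcases List.mem_cons.1 hx with h | h
    · exact Or.inl h
    · exact Or.inr (List.eq_of_mem_replicate h)
  · rw [Set.mem_ofPred_eq, ← hb] at hkU
    rw [List.prod_flatten, List.map_replicate, List.prod_replicate, List.prod_cons,
      List.prod_replicate]
    change R < opNorm (((a : Matrix (Fin 2) (Fin 2) ℝ) * (b : Matrix (Fin 2) (Fin 2) ℝ) ^ (k - 1)) ^ m)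
    rw [hab, mul_assoc, ← pow_succ', Nat.sub_add_cancel hk]
    exact hkU

lemma exists_word_exit {lam E : ℝ} (hlam : 0 < lam) (hE : |E + lam| < 2) (L : ℝ) :
    ∃ l : List (SpecialLinearGroup (Fin 2) ℝ),
      (∀ x ∈ l, x = transferSL lam E 1 ∨ x = transferSL lam E (-1)) ∧
      ∀ g ∈ {g : SpecialLinearGroup (Fin 2) ℝ | opNorm g ≤ L},
        g * l.prod ∉ {g : SpecialLinearGroup (Fin 2) ℝ | opNorm g ≤ L} := by
  obtain ⟨K, hK, hadj⟩ := exists_opNorm_adjugate_le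
  obtain ⟨l, hl, hlR⟩ := exists_word_lt_opNorm hlam hE (K * L * L)
  refine ⟨l, hl, fun g hg hgl => hlR.not_ge ?_⟩
  rw [Set.mem_ofPred_eq] at hg hgl
  have hL : 0 ≤ L := (opNorm_nonneg _).trans hg
  have e : (l.prod : Matrix (Fin 2) (Fin 2) ℝ) =
      (g : Matrix (Fin 2) (Fin 2) ℝ).adjugate *
        ((g * l.prod : SpecialLinearGroup (Fin 2) ℝ) : Matrix (Fin 2) (Fin 2) ℝ) := by
    change _ = (g : Matrix (Fin 2) (Fin 2) ℝ).adjugate * ((g : Matrix (Fin 2) (Fin 2) ℝ) * l.prod)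
    rw [← mul_assoc, Matrix.adjugate_mul, g.2, one_smul, one_mul]
  rw [e]
  exact (opNorm_mul_le _ _).trans (mul_le_mul
    ((hadj _).trans (mul_le_mul_of_nonneg_left hg hK.le)) hgl (opNorm_nonneg _) (by positivity))

/-- The walk of transfer matrices exits the ball of radius `L` into the ball of radius `2 * L`. -/
lemma opNorm_of_exitWalk_ne_zero {a b : SpecialLinearGroup (Fin 2) ℝ} {L C : ℝ} {k : ℕ}
    (hk : 0 < k) (hL : 1 ≤ L) (hC : C < 2 * L)
    (hblock : ∀ u ∈ ({a, b} : Set (SpecialLinearGroup (Fin 2) ℝ)) ^ k, opNorm u < 2)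
    (hshort : ∀ j ≤ k, ∀ u ∈ ({a, b} : Set (SpecialLinearGroup (Fin 2) ℝ)) ^ j, opNorm u ≤ C)
    {n : ℕ} {g : SpecialLinearGroup (Fin 2) ℝ}
    (hg : exitWalk a b {g : SpecialLinearGroup (Fin 2) ℝ | opNorm g ≤ L} n g ≠ 0) :
    L < opNorm g ∧ opNorm g < 2 * L := by
  have h1 : (1 : SpecialLinearGroup (Fin 2) ℝ) ∈
      {g : SpecialLinearGroup (Fin 2) ℝ | opNorm g ≤ L} := by simpa [opNorm_one] using hL
  rw [exitWalk, Set.indicator_apply_ne_zero] at hg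
  obtain ⟨hgA, hg⟩ := hg
  refine ⟨by simpa using hgA, ?_⟩
  rcases le_total (n + 1) k with hn | hn
  · obtain ⟨g', hg', u, hu, rfl⟩ := exists_of_walkStep_killedWalk_ne_zero 0 n
      (by rw [zero_add]; exact hg)
    have : g' = 1 := by
      by_contra h
      simp [killedWalk, h] at hg'
    rw [this, one_mul]
    exact (hshort _ hn u hu).trans_lt hC
  · obtain ⟨g', hg', u, hu, rfl⟩ := exists_of_walkStep_killedWalk_ne_zero (n + 1 - k) (k - 1)
      (by rw [show n + 1 - k + (k - 1) = n by omega]; exact hg)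
    rw [Nat.sub_add_cancel hk] at hu
    have hg'L : opNorm g' ≤ L := mem_of_killedWalk_ne_zero h1 hg'
    change opNorm ((g' : Matrix (Fin 2) (Fin 2) ℝ) * u) < 2 * L
    rw [mul_comm 2 L]
    refine (opNorm_mul_le _ _).trans_lt ?_
    calc opNorm g' * opNorm u ≤ L * opNorm u := by gcongr; exact opNorm_nonneg _
      _ < L * 2 := by gcongr; exact hblock u hu

end TransferMatrices

/-- A summable weight on a type is carried by a sequence of points. -/
lemma exists_seq_of_tsum_ne_top {X : Type*} [Inhabited X] {W : X → ENNReal}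
    (hW : ∑' x, W x ≠ ⊤) :
    ∃ (w : ℕ → ENNReal) (x : ℕ → X), (∀ n, w n ≠ 0 → W (x n) ≠ 0) ∧
      ∀ h : X → ENNReal, ∑' n, w n * h (x n) = ∑' y, W y * h y := by
  have := (Summable.countable_support_ennreal hW).to_subtype
  obtain ⟨e, he⟩ := exists_injective_nat (Function.support W)
  have hw : ∀ n, (∃ y, e y = n) ∨ ¬ ∃ y, e y = n := fun n => em _
  refine ⟨Function.extend e (fun y => W y) 0, Function.extend e (fun y => (y : X)) default,
    fun n hn => ?_, fun h => ?_⟩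
  · rcases hw n with ⟨y, rfl⟩ | hy
    · rw [he.extend_apply]
      exact y.2
    · exact absurd (Function.extend_apply' _ _ _ hy) hn
  · have hext : ∀ n, Function.extend e (fun y => W y) 0 n *
        h (Function.extend e (fun y => (y : X)) default n) =
        Function.extend e (fun y => W y * h y) 0 n := by
      intro n
      rcases hw n with ⟨y, rfl⟩ | hy
      · simp only [he.extend_apply]
      · simp [Function.extend_apply' _ _ _ hy]
    simp only [hext]
    rw [tsum_extend_zero he]
    exact tsum_subtype_eq_of_support_subset (f := fun y => W y * h y)
      fun y hy => left_ne_zero_of_mul hy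

/-- For small `λ` there is a discrete (countably supported) probability measure
`μ̃` on `SL₂(ℝ)`, supported on matrices `g` with `λ^{-1/10} < ‖g‖ < 2λ^{-1/10}`,
for which the Furstenberg measure is stationary:
`ν = ∫ (τ_g)_*[ν] dμ̃(g)`. -/
theorem furstenberg_stationary_discrete_measure
    (δ₀ : ℝ) (hδ₀ : 0 < δ₀) (hδ₀' : δ₀ < 1) (E : ℝ)
    (hE : δ₀ < |E|) (hE' : |E| < 2 - δ₀) :
    ∃ lam0 : ℝ, 0 < lam0 ∧
      ∀ lam : ℝ, 0 < lam → lam < lam0 →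
        ∀ ν : Measure (AddCircle (2 * Real.pi)),
          IsProbabilityMeasure ν → Stationary lam E ν →
          ∃ (w : ℕ → ENNReal) (G : ℕ → Matrix (Fin 2) (Fin 2) ℝ),
            (∑' n, w n) = 1 ∧
            (∀ n : ℕ, w n ≠ 0 →
              (G n).det = 1 ∧
              lam ^ (-(1 : ℝ) / 10) < opNorm (G n) ∧
              opNorm (G n) < 2 * lam ^ (-(1 : ℝ) / 10)) ∧
            (∀ s : Set (AddCircle (2 * Real.pi)), MeasurableSet s →
              ν s = ∑' n, w n * ν (tauMap (G n) ⁻¹' s)) := by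
  have hE2 : |E| < 2 := by linarith
  obtain ⟨k, C, hk, hev⟩ := exists_block_opNorm_lt_two hE2
  have hΛ : Filter.Tendsto (fun lam : ℝ => lam ^ (-(1 : ℝ) / 10))
      (nhdsWithin 0 (Set.Ioi 0)) Filter.atTop := tendsto_rpow_neg_nhdsGT_zero (by norm_num)
  have hellip : ∀ᶠ lam in nhds (0 : ℝ), |E + lam| < 2 := by
    have hc : Continuous fun lam : ℝ => |E + lam| := by fun_prop
    exact hc.continuousAt.eventually_lt continuousAt_const (by simpa using hE2)
  have hall := hev.and ((hellip.filter_mono nhdsWithin_le_nhds).and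
    ((hΛ.eventually_ge_atTop 1).and (hΛ.eventually_gt_atTop C)))
  obtain ⟨lam0, hlam0, hsub⟩ := mem_nhdsGT_iff_exists_Ioo_subset.1 hall
  refine ⟨lam0, hlam0, fun lam hlam hlt ν hν hst => ?_⟩
  obtain ⟨⟨hblock, hshort⟩, hlamE, h1L, hCL⟩ := hsub ⟨hlam, hlt⟩
  set L := lam ^ (-(1 : ℝ) / 10)
  set A := {g : Matrix.SpecialLinearGroup (Fin 2) ℝ | opNorm g ≤ L}
  obtain ⟨l, hl, hout⟩ := exists_word_exit hlam hlamE L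
  have h1 : (1 : Matrix.SpecialLinearGroup (Fin 2) ℝ) ∈ A := by
    simpa [A, opNorm_one] using h1L
  set W : Matrix.SpecialLinearGroup (Fin 2) ℝ → ENNReal :=
    fun g => ∑' n, exitWalk (transferSL lam E 1) (transferSL lam E (-1)) A n g
  have hexit : ∀ s : Set (AddCircle (2 * Real.pi)), MeasurableSet s →
      ∑' g : Matrix.SpecialLinearGroup (Fin 2) ℝ, W g * ν (tauMap g ⁻¹' s) = ν s := by
    intro s hs
    refine (tsum_exitWalk_mul_of_harmonic (h := fun g => ν (tauMap g ⁻¹' s)) h1 l hl hout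
      (fun _ => prob_le_one) fun g => ?_).trans (by simp [tauMap_one])
    have hpre : ∀ x, tauMap ((g * transferSL lam E x : Matrix.SpecialLinearGroup (Fin 2) ℝ) :
        Matrix (Fin 2) (Fin 2) ℝ) ⁻¹' s = tauMap (gE lam E x) ⁻¹' (tauMap g ⁻¹' s) := by
      intro x
      ext y
      rw [Matrix.SpecialLinearGroup.coe_mul, Set.mem_preimage, tauMap_mul (by simp)]
      rfl
    simp only [hpre]
    exact hst _ (measurable_tauMap _ hs)
  have hW : ∑' g, W g = 1 := by
    simpa using hexit Set.univ MeasurableSet.univ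
  obtain ⟨w, G, hwG, hsum⟩ := exists_seq_of_tsum_ne_top (W := W) (by simp [hW])
  refine ⟨w, fun n => G n, ?_, fun n hn => ⟨(G n).2, ?_⟩, fun s hs => ?_⟩
  · simpa [hW] using hsum 1
  · obtain ⟨m, hm⟩ : ∃ m, exitWalk (transferSL lam E 1) (transferSL lam E (-1)) A m (G n) ≠ 0 := by
      by_contra! h
      exact hwG n hn (ENNReal.tsum_eq_zero.2 h)
    exact opNorm_of_exitWalk_ne_zero hk h1L (by linarith) hblock hshort hm
  · rw [← hexit s hs]
    exact (hsum fun g => ν (tauMap g ⁻¹' s)).symm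
end
end
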